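/- Let w be an Oleinik solution on [0,X]. For any 0 < ε < X there exist δ₂ > 0 and a constant C > 0, independent of ψ, such that for all (x,ψ) ∈ [ε,X]×(0,δ₂]: |∂_ψ ∂ₓ w(x,ψ)| ≤ C, |∂ₓ² w(x,ψ)| ≤ C ψ^{−1/2}, and |∂_ψ² ∂ₓ w(x,ψ)| ≤ C ψ^{−1}. -/

import Mathlib

open Set

/-- Iterated partial derivative `∂ₓ^k ∂_ψ^m w` of a function of two real variables. -/
noncomputable def pd (k m : ℕ) (w : ℝ → ℝ → ℝ) (x ψ : ℝ) : ℝ :=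
  iteratedDeriv k (fun x' => iteratedDeriv m (w x') ψ) x

/-- Von Mises formulation of the steady Prandtl equation with favorable pressure:
`w` is an Oleinik solution on `[0,X]` with structural constants `α, m, M, C₀, δ₁`. -/
structure OleinikSolution (X : ℝ) (p : ℝ → ℝ) (w : ℝ → ℝ → ℝ)
    (α m M C₀ δ₁ : ℝ) : Prop where
  hX : 0 < X
  hp : ContDiff ℝ (⊤ : ℕ∞) p
  hfav : ∀ x : ℝ, deriv p x ≤ 0
  hα : α ∈ Set.Ioo (0 : ℝ) (1 / 2)
  hm : 0 < m
  hmM : m < M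
  hC₀ : 0 < C₀
  hδ₁ : δ₁ ∈ Set.Ioo (0 : ℝ) 1
  cont : ContinuousOn (fun z : ℝ × ℝ => w z.1 z.2) (Set.Icc 0 X ×ˢ Set.Ici 0)
  smooth : ContDiffOn ℝ (⊤ : ℕ∞) (fun z : ℝ × ℝ => w z.1 z.2) (Set.Ioc 0 X ×ˢ Set.Ioi 0)
  bdry : ∀ x ∈ Set.Icc (0 : ℝ) X, w x 0 = 0
  eqn : ∀ x ∈ Set.Ioc (0 : ℝ) X, ∀ ψ ∈ Set.Ioi (0 : ℝ),
    pd 1 0 w x ψ - Real.sqrt (w x ψ) * pd 0 2 w x ψ = -2 * deriv p x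
  slope_lb : ∀ x ∈ Set.Icc (0 : ℝ) X, ∀ ψ ∈ Set.Icc (0 : ℝ) δ₁, m < pd 0 1 w x ψ
  slope_ub : ∀ x ∈ Set.Icc (0 : ℝ) X, ∀ ψ ∈ Set.Icc (0 : ℝ) δ₁, pd 0 1 w x ψ < M
  growth_lb : ∀ x ∈ Set.Icc (0 : ℝ) X, ∀ ψ ∈ Set.Ioc (0 : ℝ) δ₁, m * ψ < w x ψ
  growth_ub : ∀ x ∈ Set.Icc (0 : ℝ) X, ∀ ψ ∈ Set.Ioc (0 : ℝ) δ₁, w x ψ < M * ψ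
  dx_bound : ∀ x ∈ Set.Icc (0 : ℝ) X, ∀ ψ ∈ Set.Icc (0 : ℝ) δ₁,
    |pd 1 0 w x ψ| ≤ C₀ * ψ ^ ((1 : ℝ) / 2 + α)

open Filter Topology

noncomputable def D1 (f : ℝ → ℝ → ℝ) : ℝ → ℝ → ℝ := fun x ψ => deriv (fun x' => f x' ψ) x
noncomputable def D2 (f : ℝ → ℝ → ℝ) : ℝ → ℝ → ℝ := fun x ψ => deriv (f x) ψ
def Sm (Ω : Set (ℝ × ℝ)) (f : ℝ → ℝ → ℝ) : Prop :=
  ContDiffOn ℝ (⊤ : ℕ∞) (fun z : ℝ × ℝ => f z.1 z.2) Ω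

section smooth
variable {Ω : Set (ℝ × ℝ)} {f : ℝ → ℝ → ℝ}

lemma Sm.hasF (hΩ : IsOpen Ω) (hf : Sm Ω f) {x ψ : ℝ} (h : (x, ψ) ∈ Ω) :
    HasFDerivAt (fun z : ℝ × ℝ => f z.1 z.2) (fderiv ℝ (fun z : ℝ × ℝ => f z.1 z.2) (x, ψ)) (x, ψ) :=
  ((hf.contDiffAt (hΩ.mem_nhds h)).differentiableAt (by simp)).hasFDerivAt

lemma Sm.h1' (hΩ : IsOpen Ω) (hf : Sm Ω f) {x ψ : ℝ} (h : (x, ψ) ∈ Ω) :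
    HasDerivAt (fun x' => f x' ψ) (fderiv ℝ (fun z : ℝ × ℝ => f z.1 z.2) (x, ψ) (1, 0)) x := by
  have := (hf.hasF hΩ h).comp_hasDerivAt x
    ((hasDerivAt_id x).prodMk (hasDerivAt_const x ψ))
  exact this

lemma Sm.h2' (hΩ : IsOpen Ω) (hf : Sm Ω f) {x ψ : ℝ} (h : (x, ψ) ∈ Ω) :
    HasDerivAt (f x) (fderiv ℝ (fun z : ℝ × ℝ => f z.1 z.2) (x, ψ) (0, 1)) ψ := by
  have := (hf.hasF hΩ h).comp_hasDerivAt ψ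
    ((hasDerivAt_const ψ x).prodMk (hasDerivAt_id ψ))
  exact this

lemma Sm.h1 (hΩ : IsOpen Ω) (hf : Sm Ω f) {x ψ : ℝ} (h : (x, ψ) ∈ Ω) :
    HasDerivAt (fun x' => f x' ψ) (D1 f x ψ) x :=
  (hf.h1' hΩ h).differentiableAt.hasDerivAt

lemma Sm.h2 (hΩ : IsOpen Ω) (hf : Sm Ω f) {x ψ : ℝ} (h : (x, ψ) ∈ Ω) :
    HasDerivAt (f x) (D2 f x ψ) ψ :=
  (hf.h2' hΩ h).differentiableAt.hasDerivAt

lemma Sm.smv (hΩ : IsOpen Ω) (hf : Sm Ω f) (v : ℝ × ℝ) :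
    ContDiffOn ℝ (⊤ : ℕ∞) (fun z => fderiv ℝ (fun z : ℝ × ℝ => f z.1 z.2) z v) Ω := by
  have h : ContDiffOn ℝ (⊤ : ℕ∞) (fderiv ℝ (fun z : ℝ × ℝ => f z.1 z.2)) Ω :=
    hf.fderiv_of_isOpen hΩ (by simp)
  exact h.clm_apply contDiffOn_const

lemma Sm.d1 (hΩ : IsOpen Ω) (hf : Sm Ω f) : Sm Ω (D1 f) :=
  (hf.smv hΩ (1, 0)).congr fun z hz => (hf.h1' hΩ (x := z.1) (ψ := z.2) hz).deriv

lemma Sm.d2 (hΩ : IsOpen Ω) (hf : Sm Ω f) : Sm Ω (D2 f) :=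
  (hf.smv hΩ (0, 1)).congr fun z hz => (hf.h2' hΩ (x := z.1) (ψ := z.2) hz).deriv

lemma Sm.comm (hΩ : IsOpen Ω) (hf : Sm Ω f) {x ψ : ℝ} (h : (x, ψ) ∈ Ω) :
    D1 (D2 f) x ψ = D2 (D1 f) x ψ := by
  have e1 := ((hf.d1 hΩ).h2' hΩ h).deriv
  have e2 := ((hf.d2 hΩ).h1' hΩ h).deriv
  have c1 : (fun z : ℝ × ℝ => D1 f z.1 z.2) =ᶠ[𝓝 (x, ψ)]
      fun z => fderiv ℝ (fun z : ℝ × ℝ => f z.1 z.2) z (1, 0) := by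
    filter_upwards [hΩ.mem_nhds h] with z hz
    exact (hf.h1' hΩ (x := z.1) (ψ := z.2) hz).deriv
  have c2 : (fun z : ℝ × ℝ => D2 f z.1 z.2) =ᶠ[𝓝 (x, ψ)]
      fun z => fderiv ℝ (fun z : ℝ × ℝ => f z.1 z.2) z (0, 1) := by
    filter_upwards [hΩ.mem_nhds h] with z hz
    exact (hf.h2' hΩ (x := z.1) (ψ := z.2) hz).deriv
  have hd : DifferentiableAt ℝ (fderiv ℝ (fun z : ℝ × ℝ => f z.1 z.2)) (x, ψ) := by
    have h' : ContDiffOn ℝ (⊤ : ℕ∞) (fderiv ℝ (fun z : ℝ × ℝ => f z.1 z.2)) Ω :=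
      hf.fderiv_of_isOpen hΩ (by simp)
    exact (h'.contDiffAt (hΩ.mem_nhds h)).differentiableAt (by simp)
  have hs : IsSymmSndFDerivAt ℝ (fun z : ℝ × ℝ => f z.1 z.2) (x, ψ) :=
    (hf.contDiffAt (hΩ.mem_nhds h)).isSymmSndFDerivAt (by simp; norm_cast)
  rw [c1.fderiv_eq, fderiv_clm_apply hd (by fun_prop)] at e1
  rw [c2.fderiv_eq, fderiv_clm_apply hd (by fun_prop)] at e2
  simp at e1 e2
  unfold D1 D2
  unfold D1 at e1
  unfold D2 at e2
  rw [e1, e2]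
  exact hs _ _

/-- equal on an open set implies equal derivatives -/
lemma D1_congr (hΩ : IsOpen Ω) {g : ℝ → ℝ → ℝ} (he : ∀ x ψ, (x, ψ) ∈ Ω → f x ψ = g x ψ)
    {x ψ : ℝ} (h : (x, ψ) ∈ Ω) : D1 f x ψ = D1 g x ψ := by
  apply Filter.EventuallyEq.deriv_eq
  have : ContinuousAt (fun x' : ℝ => (x', ψ)) x := by fun_prop
  filter_upwards [this (hΩ.mem_nhds h)] with y hy using he _ _ hy

lemma D2_congr (hΩ : IsOpen Ω) {g : ℝ → ℝ → ℝ} (he : ∀ x ψ, (x, ψ) ∈ Ω → f x ψ = g x ψ)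
    {x ψ : ℝ} (h : (x, ψ) ∈ Ω) : D2 f x ψ = D2 g x ψ := by
  apply Filter.EventuallyEq.deriv_eq
  have : ContinuousAt (fun y : ℝ => (x, y)) ψ := by fun_prop
  filter_upwards [this (hΩ.mem_nhds h)] with y hy using he _ _ hy

end smooth

lemma pd10 (w : ℝ → ℝ → ℝ) (x ψ : ℝ) : pd 1 0 w x ψ = D1 w x ψ := by
  simp [pd, D1, iteratedDeriv_one]
lemma pd01 (w : ℝ → ℝ → ℝ) (x ψ : ℝ) : pd 0 1 w x ψ = D2 w x ψ := by
  simp [pd, D2, iteratedDeriv_one]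
lemma pd02 (w : ℝ → ℝ → ℝ) (x ψ : ℝ) : pd 0 2 w x ψ = D2 (D2 w) x ψ := by
  simp [pd, D2, iteratedDeriv_succ]; rfl
lemma pd11 (w : ℝ → ℝ → ℝ) (x ψ : ℝ) : pd 1 1 w x ψ = D1 (D2 w) x ψ := by
  simp [pd, D1, D2, iteratedDeriv_succ]
lemma pd20 (w : ℝ → ℝ → ℝ) (x ψ : ℝ) : pd 2 0 w x ψ = D1 (D1 w) x ψ := by
  simp [pd, D1, iteratedDeriv_succ]
lemma pd12 (w : ℝ → ℝ → ℝ) (x ψ : ℝ) : pd 1 2 w x ψ = D1 (D2 (D2 w)) x ψ := by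
  simp [pd, D1, D2, iteratedDeriv_succ]; rfl

/-- endpoint bound -/
lemma endpoint {g : ℝ → ℝ} {ε X K : ℝ} (hK : 0 ≤ K) (hεX : ε < X)
    (hd : ∀ x ∈ Ico ε X, DifferentiableAt ℝ g x)
    (hb : ∀ x ∈ Ico ε X, |deriv g x| ≤ K) : |deriv g X| ≤ K := by
  by_cases hX : DifferentiableAt ℝ g X
  · have hl : ∀ x ∈ Ico ε X, ∀ y ∈ Ico ε X, ‖g y - g x‖ ≤ K * ‖y - x‖ := fun x hx y hy =>
      (convex_Ico ε X).norm_image_sub_le_of_norm_deriv_le hd (by simpa using hb) hx hy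
    have hl2 : ∀ x ∈ Ico ε X, ‖g x - g X‖ ≤ K * ‖x - X‖ := by
      intro x hx
      have t1 : Tendsto (fun y => ‖g x - g y‖) (𝓝[<] X) (𝓝 ‖g x - g X‖) :=
        ((tendsto_const_nhds.sub hX.continuousAt.tendsto).norm).mono_left nhdsWithin_le_nhds
      have t2 : Tendsto (fun y => K * ‖x - y‖) (𝓝[<] X) (𝓝 (K * ‖x - X‖)) := by
        have : Continuous fun y => K * ‖x - y‖ := by fun_prop
        exact (this.tendsto X).mono_left nhdsWithin_le_nhds
      refine le_of_tendsto_of_tendsto t1 t2 ?_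
      filter_upwards [Ico_mem_nhdsLT hεX] with y hy using hl y hy x hx
    have hs := (hasDerivAt_iff_tendsto_slope.1 hX.hasDerivAt).mono_left
      (nhdsWithin_mono X (fun y (hy : y < X) => (ne_of_lt hy)) : 𝓝[<] X ≤ _)
    refine le_of_tendsto hs.abs ?_
    filter_upwards [Ico_mem_nhdsLT hεX] with y hy
    rw [slope_def_field, abs_div]
    have : 0 < |y - X| := abs_pos.2 (sub_ne_zero.2 hy.2.ne)
    rw [div_le_iff₀ this]
    exact hl2 y hy
  · rw [deriv_zero_of_not_differentiableAt hX]; simpa using hK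

/-- maximum principle on a rectangle -/
lemma maxpr {t0 t1 s0 s1 : ℝ} {h ht hs hss : ℝ → ℝ → ℝ}
    (hc : ContinuousOn (fun z : ℝ × ℝ => h z.1 z.2) (Icc t0 t1 ×ˢ Icc s0 s1))
    (d1 : ∀ t ∈ Ioc t0 t1, ∀ s ∈ Ioo s0 s1, HasDerivAt (fun t' => h t' s) (ht t s) t)
    (d2 : ∀ t ∈ Ioc t0 t1, ∀ s ∈ Ioo s0 s1, HasDerivAt (h t) (hs t s) s)
    (d3 : ∀ t ∈ Ioc t0 t1, ∀ s ∈ Ioo s0 s1, HasDerivAt (hs t) (hss t s) s)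
    (b0 : ∀ s ∈ Icc s0 s1, h t0 s ≤ 0)
    (b1 : ∀ t ∈ Icc t0 t1, h t s0 ≤ 0)
    (b2 : ∀ t ∈ Icc t0 t1, h t s1 ≤ 0)
    (key : ∀ t ∈ Ioc t0 t1, ∀ s ∈ Ioo s0 s1, 0 < h t s → hs t s = 0 → 0 ≤ ht t s →
      hss t s ≤ 0 → False) :
    ∀ t ∈ Icc t0 t1, ∀ s ∈ Icc s0 s1, h t s ≤ 0 := by
  intro t htt s hss'
  by_contra! hpos
  obtain ⟨⟨τ, σ⟩, ⟨hτ, hσ⟩, hmax⟩ := (isCompact_Icc.prod isCompact_Icc).exists_isMaxOn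
    ⟨(t, s), htt, hss'⟩ hc
  simp only at hτ hσ
  have hge : ∀ t' ∈ Icc t0 t1, ∀ s' ∈ Icc s0 s1, h t' s' ≤ h τ σ := fun t' h1 s' h2 =>
    hmax (show (t', s') ∈ _ from ⟨h1, h2⟩)
  have hp : 0 < h τ σ := hpos.trans_le (hge t htt s hss')
  have hτ' : τ ∈ Ioc t0 t1 := by
    refine ⟨lt_of_le_of_ne hτ.1 ?_, hτ.2⟩
    rintro rfl; exact absurd (b0 σ hσ) (not_le.2 hp)
  have hσ' : σ ∈ Ioo s0 s1 := by
    refine ⟨lt_of_le_of_ne hσ.1 ?_, lt_of_le_of_ne hσ.2 ?_⟩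
    · rintro rfl; exact absurd (b1 τ hτ) (not_le.2 hp)
    · rintro rfl; exact absurd (b2 τ hτ) (not_le.2 hp)
  have hlm : IsLocalMax (h τ) σ := by
    filter_upwards [Ioo_mem_nhds hσ'.1 hσ'.2] with y hy
    exact hge τ hτ y ⟨hy.1.le, hy.2.le⟩
  have hs0 : hs τ σ = 0 := hlm.hasDerivAt_eq_zero (d2 τ hτ' σ hσ')
  refine key τ hτ' σ hσ' hp hs0 ?_ ?_
  · have hsl := (hasDerivAt_iff_tendsto_slope.1 (d1 τ hτ' σ hσ')).mono_left
      (nhdsWithin_mono τ (fun y (hy : y < τ) => (ne_of_lt hy)) : 𝓝[<] τ ≤ _)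
    refine ge_of_tendsto hsl ?_
    filter_upwards [Ico_mem_nhdsLT hτ'.1] with y hy
    rw [slope_def_field]
    apply div_nonneg_of_nonpos
    · have := hge y ⟨hy.1, hy.2.le.trans hτ.2⟩ σ hσ
      linarith
    · linarith [hy.2]
  · by_contra! hss0
    have hev : deriv (h τ) =ᶠ[𝓝 σ] hs τ := by
      filter_upwards [Ioo_mem_nhds hσ'.1 hσ'.2] with y hy
      exact (d2 τ hτ' y hy).deriv
    have hdd : deriv (deriv (h τ)) σ = hss τ σ := by
      rw [hev.deriv_eq]; exact (d3 τ hτ' σ hσ').deriv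
    have hmin : IsLocalMin (h τ) σ := isLocalMin_of_deriv_deriv_pos (by rw [hdd]; exact hss0)
      (by rw [(d2 τ hτ' σ hσ').deriv, hs0]) (d2 τ hτ' σ hσ').continuousAt
    have hconst : h τ =ᶠ[𝓝 σ] fun _ => h τ σ := by
      filter_upwards [hmin, hlm] with y h1 h2
      exact le_antisymm h2 h1
    have : deriv (deriv (h τ)) σ = 0 := by
      rw [hconst.deriv.deriv_eq]; simp
    linarith

lemma bern_alg {lam Lam K ζ ζt ζs ζss Y Yt Ys Yss y yt ys yss A B G : ℝ} (hl : 0 < lam)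
    (hL : 0 ≤ Lam)
    (z0 : 0 ≤ ζ) (z1 : ζ ≤ 1) (zt0 : 0 ≤ ζt) (zt1 : ζt ≤ 1) (zs : ζs ^ 2 ≤ 16) (zss : -8 ≤ ζss)
    (zss0 : ζss ≤ 0)
    (hA : lam ≤ A) (hA' : A ≤ Lam) (hB : |B| ≤ Lam) (hG : |G| ≤ Lam * (1 + |Y|))
    (hY : Yt = A * Yss + B * Ys + G)
    (hK : K = (2 + 275 * Lam + Lam ^ 2 / lam + 1) / lam)
    (hy : 2 * y * yt - A * (2 * ys ^ 2 + 2 * y * yss) ≤ - lam * Y ^ 2 + Lam) :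
    (2 * ζ * ζt * Y ^ 2 + 2 * ζ ^ 2 * Y * Yt + 2 * K * y * yt) -
    A * (2 * (ζs ^ 2 + ζ * ζss) * Y ^ 2 + 8 * ζ * ζs * Y * Ys + 2 * ζ ^ 2 * (Ys ^ 2 + Y * Yss)
      + 2 * K * (ys ^ 2 + y * yss)) ≤ - Y ^ 2 + (Lam + K * Lam) := by
  have hA0 : 0 < A := hl.trans_le hA
  have hK0 : 0 ≤ K := by rw [hK]; positivity
  have hKl : K * lam = 2 + 275 * Lam + Lam ^ 2 / lam + 1 := by rw [hK]; field_simp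
  have hz2 : ζ ^ 2 ≤ 1 := pow_le_one₀ z0 z1
  have e1 : - (8 * A * ζ * ζs * Y * Ys) ≤ A * ζ ^ 2 * Ys ^ 2 + 256 * Lam * Y ^ 2 := by
    have h1 : 0 ≤ A * (ζ * Ys + 4 * ζs * Y) ^ 2 := by positivity
    have h2 : A * ζs ^ 2 ≤ Lam * 16 := mul_le_mul hA' zs (by positivity) hL
    have h3 := mul_le_mul_of_nonneg_right h2 (sq_nonneg Y)
    linarith
  have e2 : 2 * ζ ^ 2 * Y * B * Ys ≤ A * ζ ^ 2 * Ys ^ 2 + Lam ^ 2 / lam * Y ^ 2 := by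
    have hBq : B ^ 2 ≤ Lam ^ 2 := sq_le_sq' (by linarith [(abs_le.1 hB).1]) (abs_le.1 hB).2
    have h1 : 0 ≤ ζ ^ 2 / A * (A * Ys - B * Y) ^ 2 := by positivity
    have h1' : ζ ^ 2 / A * (A * Ys - B * Y) ^ 2
        = A * ζ ^ 2 * Ys ^ 2 - 2 * ζ ^ 2 * Y * B * Ys + ζ ^ 2 * (B ^ 2 / A) * Y ^ 2 := by
      field_simp
      ring
    have h2 : B ^ 2 / A ≤ Lam ^ 2 / lam := by gcongr
    have h3 : ζ ^ 2 * (B ^ 2 / A) ≤ 1 * (Lam ^ 2 / lam) :=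
      mul_le_mul hz2 h2 (by positivity) (by norm_num)
    have h4 := mul_le_mul_of_nonneg_right h3 (sq_nonneg Y)
    linarith
  have e3 : 2 * ζ ^ 2 * Y * G ≤ Lam + 3 * Lam * Y ^ 2 := by
    have h1 : Y * G ≤ |Y| * (Lam * (1 + |Y|)) := by
      calc Y * G ≤ |Y * G| := le_abs_self _
        _ = |Y| * |G| := abs_mul _ _
        _ ≤ _ := by gcongr
    have h2 : 2 * (|Y| * (Lam * (1 + |Y|))) ≤ Lam + 3 * Lam * Y ^ 2 := by
      have : Lam * |Y| ^ 2 = Lam * Y ^ 2 := by rw [sq_abs]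
      have h3 : 0 ≤ Lam * (|Y| - 1) ^ 2 := by positivity
      linarith
    have h5 : 0 ≤ |Y| * (Lam * (1 + |Y|)) := by positivity
    have h6 : ζ ^ 2 * (Y * G) ≤ 1 * (|Y| * (Lam * (1 + |Y|))) := by
      calc ζ ^ 2 * (Y * G) ≤ ζ ^ 2 * (|Y| * (Lam * (1 + |Y|))) := by gcongr
        _ ≤ _ := by gcongr
    linarith
  have e4 : 2 * ζ * ζt * Y ^ 2 ≤ 2 * Y ^ 2 := by
    have : ζ * ζt ≤ 1 := mul_le_one₀ z1 zt0 zt1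
    linarith [mul_le_mul_of_nonneg_right this (sq_nonneg Y)]
  have e5 : - (A * (2 * (ζs ^ 2 + ζ * ζss) * Y ^ 2)) ≤ 16 * Lam * Y ^ 2 := by
    have h1 : -8 ≤ ζ * ζss := by
      have := mul_nonneg (sub_nonneg.2 z1) (neg_nonneg.2 zss0)
      linarith
    have h2 : -(ζs ^ 2 + ζ * ζss) ≤ 8 := by linarith [sq_nonneg ζs]
    have h3 : A * -(ζs ^ 2 + ζ * ζss) ≤ Lam * 8 := by
      calc A * -(ζs ^ 2 + ζ * ζss) ≤ A * 8 := by gcongr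
        _ ≤ _ := by gcongr
    linarith [mul_le_mul_of_nonneg_right h3 (sq_nonneg Y)]
  have e6 := mul_le_mul_of_nonneg_left hy hK0
  have e7 : K * (-lam * Y ^ 2 + Lam) = - (2 + 275 * Lam + Lam ^ 2 / lam + 1) * Y ^ 2 + K * Lam := by
    rw [← hKl]; ring
  rw [hY]
  linarith

lemma bern {lam Lam : ℝ} (hl : 0 < lam) (hL : 0 ≤ Lam) : ∃ K > 0,
    ∀ (A B G Y Yt Ys Yss y yt ys yss : ℝ → ℝ → ℝ),
    ContinuousOn (fun z : ℝ × ℝ => Y z.1 z.2) (Icc (-1) 0 ×ˢ Icc (1 / 2) (3 / 2)) →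
    ContinuousOn (fun z : ℝ × ℝ => y z.1 z.2) (Icc (-1) 0 ×ˢ Icc (1 / 2) (3 / 2)) →
    (∀ t ∈ Icc (-1 : ℝ) 0, ∀ s ∈ Icc (1 / 2 : ℝ) (3 / 2),
      HasDerivAt (fun t' => Y t' s) (Yt t s) t ∧ HasDerivAt (Y t) (Ys t s) s ∧
      HasDerivAt (Ys t) (Yss t s) s ∧
      HasDerivAt (fun t' => y t' s) (yt t s) t ∧ HasDerivAt (y t) (ys t s) s ∧
      HasDerivAt (ys t) (yss t s) s ∧
      lam ≤ A t s ∧ A t s ≤ Lam ∧ |B t s| ≤ Lam ∧ |G t s| ≤ Lam * (1 + |Y t s|) ∧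
      |y t s| ≤ Lam ∧
      Yt t s = A t s * Yss t s + B t s * Ys t s + G t s ∧
      2 * y t s * yt t s - A t s * (2 * ys t s ^ 2 + 2 * y t s * yss t s)
        ≤ - lam * Y t s ^ 2 + Lam) → |Y 0 1| ≤ K := by
  set K := (2 + 275 * Lam + Lam ^ 2 / lam + 1) / lam with hK
  have hK0 : 0 ≤ K := by positivity
  set R0 := (Lam + K * Lam) + K * Lam ^ 2 with hR0
  have hR00 : 0 ≤ R0 := by positivity
  refine ⟨R0 + 1, by positivity, ?_⟩
  intro A B G Y Yt Ys Yss y yt ys yss cY cy H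
  have main := maxpr (t0 := -1) (t1 := 0) (s0 := 1/2) (s1 := 3/2)
    (h := fun t s => (4 * (1 + t) * (s - 1/2) * (3/2 - s)) ^ 2 * Y t s ^ 2 + K * y t s ^ 2 - R0)
    (ht := fun t s => 2 * (4 * (1 + t) * (s - 1/2) * (3/2 - s)) * (4 * (s - 1/2) * (3/2 - s))
      * Y t s ^ 2 + 2 * (4 * (1 + t) * (s - 1/2) * (3/2 - s)) ^ 2 * Y t s * Yt t s
      + 2 * K * y t s * yt t s)
    (hs := fun t s => 2 * (4 * (1 + t) * (s - 1/2) * (3/2 - s)) * (4 * (1 + t) * (2 - 2 * s))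
      * Y t s ^ 2 + 2 * (4 * (1 + t) * (s - 1/2) * (3/2 - s)) ^ 2 * Y t s * Ys t s
      + 2 * K * y t s * ys t s)
    (hss := fun t s => 2 * ((4 * (1 + t) * (2 - 2 * s)) ^ 2 +
        (4 * (1 + t) * (s - 1/2) * (3/2 - s)) * (-8 * (1 + t))) * Y t s ^ 2
      + 8 * (4 * (1 + t) * (s - 1/2) * (3/2 - s)) * (4 * (1 + t) * (2 - 2 * s)) * Y t s * Ys t s
      + 2 * (4 * (1 + t) * (s - 1/2) * (3/2 - s)) ^ 2 * (Ys t s ^ 2 + Y t s * Yss t s)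
      + 2 * K * (ys t s ^ 2 + y t s * yss t s))
    ?_ ?_ ?_ ?_ ?_ ?_ ?_ ?_ 0 (by norm_num) 1 (by norm_num)
  · norm_num at main
    have h1 : Y 0 1 ^ 2 ≤ R0 := by linarith [mul_nonneg hK0 (sq_nonneg (y 0 1))]
    exact abs_le_of_sq_le_sq (by linarith [sq_nonneg R0, add_sq R0 1]) (by positivity)
  · have hz : ContinuousOn (fun z : ℝ × ℝ => (4 * (1 + z.1) * (z.2 - 1/2) * (3/2 - z.2)) ^ 2)
      (Icc (-1) 0 ×ˢ Icc (1 / 2) (3 / 2)) := by fun_prop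
    exact ((hz.mul (cY.pow 2)).add (continuousOn_const.mul (cy.pow 2))).sub continuousOn_const
  · intro t ht s hs
    obtain ⟨h1, h2, h3, h4, h5, h6, -⟩ := H t (Ioc_subset_Icc_self ht) s (Ioo_subset_Icc_self hs)
    have hz : HasDerivAt (fun t' : ℝ => 4 * (1 + t') * (s - 1/2) * (3/2 - s))
      (4 * (s - 1/2) * (3/2 - s)) t := by
      have := ((((hasDerivAt_id t).const_add 1).const_mul 4).mul_const (s - 1/2)).mul_const (3/2 - s)
      simpa using this
    have := (((hz.pow 2).mul (h1.pow 2)).add ((h4.pow 2).const_mul K)).sub_const R0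
    refine this.congr_deriv ?_
    simp only [Nat.cast_ofNat, Nat.reduceSub, pow_one, Pi.pow_apply]; ring
  · intro t ht s hs
    obtain ⟨h1, h2, h3, h4, h5, h6, -⟩ := H t (Ioc_subset_Icc_self ht) s (Ioo_subset_Icc_self hs)
    have hz : HasDerivAt (fun s' : ℝ => 4 * (1 + t) * (s' - 1/2) * (3/2 - s'))
      (4 * (1 + t) * (2 - 2 * s)) s := by
      have := (((hasDerivAt_id s).sub_const (1/2)).const_mul (4 * (1 + t))).mul
        ((hasDerivAt_id s).const_sub (3/2))
      refine this.congr_deriv ?_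
      simp only [id]; ring
    have := (((hz.pow 2).mul (h2.pow 2)).add ((h5.pow 2).const_mul K)).sub_const R0
    refine this.congr_deriv ?_
    simp only [Nat.cast_ofNat, Nat.reduceSub, pow_one, Pi.pow_apply]; ring
  · intro t ht s hs
    obtain ⟨h1, h2, h3, h4, h5, h6, -⟩ := H t (Ioc_subset_Icc_self ht) s (Ioo_subset_Icc_self hs)
    have hz : HasDerivAt (fun s' : ℝ => 4 * (1 + t) * (s' - 1/2) * (3/2 - s'))
      (4 * (1 + t) * (2 - 2 * s)) s := by
      have := (((hasDerivAt_id s).sub_const (1/2)).const_mul (4 * (1 + t))).mul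
        ((hasDerivAt_id s).const_sub (3/2))
      refine this.congr_deriv ?_
      simp only [id]; ring
    have hz2 : HasDerivAt (fun s' : ℝ => 4 * (1 + t) * (2 - 2 * s')) (-8 * (1 + t)) s := by
      have := (((hasDerivAt_id s).const_mul 2).const_sub 2).const_mul (4 * (1 + t))
      refine this.congr_deriv ?_
      ring
    have := ((((hz.const_mul 2).mul hz2).mul (h2.pow 2)).add
      ((((hz.pow 2).const_mul 2).mul h2).mul h3)).add ((h5.const_mul (2 * K)).mul h6)
    refine this.congr_deriv ?_
    simp only [Nat.cast_ofNat, Nat.reduceSub, pow_one, Pi.pow_apply, Pi.mul_apply]; ring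
  · intro s hs
    obtain ⟨h1, h2, h3, h4, h5, h6, -, -, -, -, h7, -⟩ := H (-1) (by norm_num) s hs
    have : y (-1) s ^ 2 ≤ Lam ^ 2 := sq_le_sq' (by linarith [(abs_le.1 h7).1]) (abs_le.1 h7).2
    have := mul_le_mul_of_nonneg_left this hK0
    have h0 : 0 ≤ Lam + K * Lam := by positivity
    simp; linarith
  · intro t ht
    obtain ⟨h1, h2, h3, h4, h5, h6, -, -, -, -, h7, -⟩ := H t ht (1/2) (by norm_num)
    have : y t (1/2) ^ 2 ≤ Lam ^ 2 := sq_le_sq' (by linarith [(abs_le.1 h7).1]) (abs_le.1 h7).2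
    have := mul_le_mul_of_nonneg_left this hK0
    have h0 : 0 ≤ Lam + K * Lam := by positivity
    simp at this ⊢; linarith
  · intro t ht
    obtain ⟨h1, h2, h3, h4, h5, h6, -, -, -, -, h7, -⟩ := H t ht (3/2) (by norm_num)
    have : y t (3/2) ^ 2 ≤ Lam ^ 2 := sq_le_sq' (by linarith [(abs_le.1 h7).1]) (abs_le.1 h7).2
    have := mul_le_mul_of_nonneg_left this hK0
    have h0 : 0 ≤ Lam + K * Lam := by positivity
    simp at this ⊢; linarith
  · intro t ht s hs hpos _ hht hhss
    obtain ⟨-, -, -, -, -, -, a1, a2, a3, a4, a5, a6, a7⟩ :=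
      H t (Ioc_subset_Icc_self ht) s (Ioo_subset_Icc_self hs)
    have k0 : 0 ≤ (s - 1/2) * (3/2 - s) := by
      have := hs.1; have := hs.2; apply mul_nonneg <;> linarith
    have k1 : 4 * ((s - 1/2) * (3/2 - s)) ≤ 1 := by linarith [sq_nonneg (s - 1)]
    have k2 : 0 ≤ 1 + t := by linarith [ht.1]
    have k3 : 1 + t ≤ 1 := by linarith [ht.2]
    have z0 : 0 ≤ 4 * (1 + t) * (s - 1/2) * (3/2 - s) := by
      have := mul_nonneg k2 k0; linarith
    have z1 : 4 * (1 + t) * (s - 1/2) * (3/2 - s) ≤ 1 := by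
      have := mul_le_mul k3 k1 (by positivity) (by norm_num); linarith
    have key := bern_alg (ζ := 4 * (1 + t) * (s - 1/2) * (3/2 - s))
      (ζt := 4 * (s - 1/2) * (3/2 - s)) (ζs := 4 * (1 + t) * (2 - 2 * s))
      (ζss := -8 * (1 + t)) hl hL z0 z1 (by linarith) (by linarith) ?_
      (by linarith) (by linarith) a1 a2 a3 a4 a6 hK a7
    · have hAp : 0 < A t s := hl.trans_le a1
      have hneg := mul_nonneg_of_nonpos_of_nonpos (neg_nonpos.2 hAp.le) hhss
      have hyb : y t s ^ 2 ≤ Lam ^ 2 := sq_le_sq' (by linarith [(abs_le.1 a5).1]) (abs_le.1 a5).2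
      have hyb' := mul_le_mul_of_nonneg_left hyb hK0
      have hz2 : (4 * (1 + t) * (s - 1/2) * (3/2 - s)) ^ 2 ≤ 1 := pow_le_one₀ z0 z1
      have hz3 := mul_le_mul_of_nonneg_right hz2 (sq_nonneg (Y t s))
      linarith
    · have : (4 * (1 + t) * (2 - 2 * s)) ^ 2 = 16 * ((1 + t) ^ 2 * (2 - 2 * s) ^ 2) := by ring
      rw [this]
      have q1 : (1 + t) ^ 2 ≤ 1 := pow_le_one₀ k2 k3
      have q2 : (2 - 2 * s) ^ 2 ≤ 1 := by
        rw [sq_le_one_iff_abs_le_one, abs_le]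
        constructor <;> linarith [hs.1, hs.2]
      have := mul_le_mul q1 q2 (by positivity) (by norm_num)
      linarith

lemma bern_scaled {lam Lam : ℝ} (hl : 0 < lam) (hL : 0 ≤ Lam) : ∃ K > 0,
    ∀ (Ω : Set (ℝ × ℝ)) (Y y a b g : ℝ → ℝ → ℝ) (r k l xs : ℝ), IsOpen Ω → 0 < r →
    Sm Ω Y → Sm Ω y →
    (∀ x ∈ Icc (xs - r ^ 3) xs, ∀ ψ ∈ Icc (r ^ 2 / 2) (3 * r ^ 2 / 2), (x, ψ) ∈ Ω ∧
      lam * r ≤ a x ψ ∧ a x ψ ≤ Lam * r ∧ r * |b x ψ| ≤ Lam ∧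
      |l * (r ^ 3 * g x ψ)| ≤ Lam * (1 + |l * Y x ψ|) ∧ |k * y x ψ| ≤ Lam ∧
      D1 Y x ψ = a x ψ * D2 (D2 Y) x ψ + b x ψ * D2 Y x ψ + g x ψ ∧
      k ^ 2 * r ^ 3 * (2 * y x ψ * D1 y x ψ - a x ψ * (2 * D2 y x ψ ^ 2 +
        2 * y x ψ * D2 (D2 y) x ψ)) ≤ - lam * (l * Y x ψ) ^ 2 + Lam) →
    |l * Y xs (r ^ 2)| ≤ K := by
  obtain ⟨K, hK, HK⟩ := bern hl hL
  refine ⟨K, hK, ?_⟩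
  intro Ω Y y a b g r k l xs hΩ hr sY sy H
  have box : ∀ t ∈ Icc (-1 : ℝ) 0, ∀ s ∈ Icc (1 / 2 : ℝ) (3 / 2),
      xs + r ^ 3 * t ∈ Icc (xs - r ^ 3) xs ∧ r ^ 2 * s ∈ Icc (r ^ 2 / 2) (3 * r ^ 2 / 2) := by
    intro t ht s hs
    have h3 : 0 < r ^ 3 := by positivity
    have h2 : 0 < r ^ 2 := by positivity
    have := mul_le_mul_of_nonneg_left ht.1 h3.le
    have := mul_le_mul_of_nonneg_left ht.2 h3.le
    have := mul_le_mul_of_nonneg_left hs.1 h2.le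
    have := mul_le_mul_of_nonneg_left hs.2 h2.le
    refine ⟨⟨?_, ?_⟩, ⟨?_, ?_⟩⟩ <;> linarith
  have cc : ∀ (f : ℝ → ℝ → ℝ) (c : ℝ), Sm Ω f → ContinuousOn
      (fun z : ℝ × ℝ => c * f (xs + r ^ 3 * z.1) (r ^ 2 * z.2))
      (Icc (-1) 0 ×ˢ Icc (1 / 2) (3 / 2)) := by
    intro f c hf
    refine continuousOn_const.mul ?_
    refine (ContDiffOn.continuousOn hf).comp
      (f := fun z : ℝ × ℝ => (xs + r ^ 3 * z.1, r ^ 2 * z.2)) (by fun_prop) ?_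
    rintro ⟨t, s⟩ ⟨ht, hs⟩
    obtain ⟨b1, b2⟩ := box t ht s hs
    exact (H _ b1 _ b2).1
  have c1 : ∀ (f : ℝ → ℝ → ℝ) (c : ℝ), Sm Ω f → ∀ t ∈ Icc (-1 : ℝ) 0,
      ∀ s ∈ Icc (1 / 2 : ℝ) (3 / 2),
      HasDerivAt (fun t' => c * f (xs + r ^ 3 * t') (r ^ 2 * s))
        (c * (r ^ 3 * D1 f (xs + r ^ 3 * t) (r ^ 2 * s))) t := by
    intro f c hf t ht s hs
    obtain ⟨b1, b2⟩ := box t ht s hs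
    have h1 := hf.h1 hΩ (H _ b1 _ b2).1
    have h2 : HasDerivAt (fun t' => xs + r ^ 3 * t') (r ^ 3) t := by
      simpa using ((hasDerivAt_id t).const_mul (r ^ 3)).const_add xs
    refine ((h1.comp t h2).const_mul c).congr_deriv ?_
    ring
  have c2 : ∀ (f : ℝ → ℝ → ℝ) (c : ℝ), Sm Ω f → ∀ t ∈ Icc (-1 : ℝ) 0,
      ∀ s ∈ Icc (1 / 2 : ℝ) (3 / 2),
      HasDerivAt (fun s' => c * f (xs + r ^ 3 * t) (r ^ 2 * s'))
        (c * r ^ 2 * D2 f (xs + r ^ 3 * t) (r ^ 2 * s)) s := by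
    intro f c hf t ht s hs
    obtain ⟨b1, b2⟩ := box t ht s hs
    have h1 := hf.h2 hΩ (H _ b1 _ b2).1
    have h2 : HasDerivAt (fun s' => r ^ 2 * s') (r ^ 2) s := by
      simpa using ((hasDerivAt_id s).const_mul (r ^ 2))
    refine ((h1.comp s h2).const_mul c).congr_deriv ?_
    ring
  have := HK (fun t s => a (xs + r ^ 3 * t) (r ^ 2 * s) / r)
    (fun t s => r * b (xs + r ^ 3 * t) (r ^ 2 * s))
    (fun t s => l * (r ^ 3 * g (xs + r ^ 3 * t) (r ^ 2 * s)))
    (fun t s => l * Y (xs + r ^ 3 * t) (r ^ 2 * s))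
    (fun t s => l * (r ^ 3 * D1 Y (xs + r ^ 3 * t) (r ^ 2 * s)))
    (fun t s => l * r ^ 2 * D2 Y (xs + r ^ 3 * t) (r ^ 2 * s))
    (fun t s => l * r ^ 2 * r ^ 2 * D2 (D2 Y) (xs + r ^ 3 * t) (r ^ 2 * s))
    (fun t s => k * y (xs + r ^ 3 * t) (r ^ 2 * s))
    (fun t s => k * (r ^ 3 * D1 y (xs + r ^ 3 * t) (r ^ 2 * s)))
    (fun t s => k * r ^ 2 * D2 y (xs + r ^ 3 * t) (r ^ 2 * s))
    (fun t s => k * r ^ 2 * r ^ 2 * D2 (D2 y) (xs + r ^ 3 * t) (r ^ 2 * s))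
    (cc Y l sY) (cc y k sy) ?_
  · simpa using this
  · intro t ht s hs
    obtain ⟨b1, b2⟩ := box t ht s hs
    obtain ⟨h0, h1, h2, h3, h4, h5, h6, h7⟩ := H _ b1 _ b2
    refine ⟨c1 Y l sY t ht s hs, c2 Y l sY t ht s hs, c2 (D2 Y) (l * r ^ 2) (sY.d2 hΩ) t ht s hs,
      c1 y k sy t ht s hs, c2 y k sy t ht s hs, c2 (D2 y) (k * r ^ 2) (sy.d2 hΩ) t ht s hs,
      ?_, ?_, ?_, h4, h5, ?_, ?_⟩
    · rw [le_div_iff₀ hr]; exact h1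
    · rw [div_le_iff₀ hr]; exact h2
    · rw [abs_mul, abs_of_pos hr]; exact h3
    · rw [h6]; field_simp
    · refine le_trans (le_of_eq ?_) h7
      field_simp

section eqs
variable {X : ℝ} {p : ℝ → ℝ} {w : ℝ → ℝ → ℝ} {α m M C₀ δ₁ : ℝ}

def Om (X δ : ℝ) : Set (ℝ × ℝ) := Ioo 0 X ×ˢ Ioo 0 δ

lemma isOpen_Om (X δ : ℝ) : IsOpen (Om X δ) := isOpen_Ioo.prod isOpen_Ioo

noncomputable def Ff (p : ℝ → ℝ) (w : ℝ → ℝ → ℝ) (x ψ : ℝ) : ℝ :=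
  D1 w x ψ * (D1 w x ψ + 2 * deriv p x) / (2 * w x ψ) - 2 * deriv (deriv p) x

lemma smw (hw : OleinikSolution X p w α m M C₀ δ₁) : Sm (Om X δ₁) w :=
  hw.smooth.mono (prod_mono (fun _ h => ⟨h.1, h.2.le⟩) (fun _ h => h.1))

lemma wpos (hw : OleinikSolution X p w α m M C₀ δ₁) {x ψ : ℝ} (h : (x, ψ) ∈ Om X δ₁) :
    0 < w x ψ := by
  have := hw.growth_lb x ⟨h.1.1.le, h.1.2.le⟩ ψ ⟨h.2.1, h.2.2.le⟩
  have h1 : 0 < m * ψ := mul_pos hw.hm h.2.1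
  linarith

lemma hp1 (hw : OleinikSolution X p w α m M C₀ δ₁) (x : ℝ) :
    HasDerivAt (deriv p) (deriv (deriv p) x) x := by
  have h : ContDiff ℝ (⊤ : ℕ∞) (deriv p) := (contDiff_infty_iff_deriv.1 hw.hp).2
  exact (h.differentiable (by simp) x).hasDerivAt

lemma hp2 (hw : OleinikSolution X p w α m M C₀ δ₁) (x : ℝ) :
    HasDerivAt (deriv (deriv p)) (deriv (deriv (deriv p)) x) x := by
  have h : ContDiff ℝ (⊤ : ℕ∞) (deriv p) := (contDiff_infty_iff_deriv.1 hw.hp).2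
  have h2 : ContDiff ℝ (⊤ : ℕ∞) (deriv (deriv p)) := (contDiff_infty_iff_deriv.1 h).2
  exact (h2.differentiable (by simp) x).hasDerivAt

lemma pbound (hw : OleinikSolution X p w α m M C₀ δ₁) : ∃ P > 0, ∀ x ∈ Icc 0 X,
    |deriv p x| ≤ P ∧ |deriv (deriv p) x| ≤ P ∧ |deriv (deriv (deriv p)) x| ≤ P := by
  have h : ContDiff ℝ (⊤ : ℕ∞) (deriv p) := (contDiff_infty_iff_deriv.1 hw.hp).2
  have h2 : ContDiff ℝ (⊤ : ℕ∞) (deriv (deriv p)) := (contDiff_infty_iff_deriv.1 h).2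
  have h3 : ContDiff ℝ (⊤ : ℕ∞) (deriv (deriv (deriv p))) := (contDiff_infty_iff_deriv.1 h2).2
  obtain ⟨P1, hP1⟩ := isCompact_Icc.exists_bound_of_continuousOn (s := Icc 0 X) h.continuous.continuousOn
  obtain ⟨P2, hP2⟩ := isCompact_Icc.exists_bound_of_continuousOn (s := Icc 0 X) h2.continuous.continuousOn
  obtain ⟨P3, hP3⟩ := isCompact_Icc.exists_bound_of_continuousOn (s := Icc 0 X) h3.continuous.continuousOn
  refine ⟨|P1| + |P2| + |P3| + 1, by positivity, fun x hx => ⟨?_, ?_, ?_⟩⟩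
  · have := hP1 x hx
    rw [Real.norm_eq_abs] at this
    linarith [le_abs_self P1, abs_nonneg P2, abs_nonneg P3]
  · have := hP2 x hx
    rw [Real.norm_eq_abs] at this
    linarith [le_abs_self P2, abs_nonneg P1, abs_nonneg P3]
  · have := hP3 x hx
    rw [Real.norm_eq_abs] at this
    linarith [le_abs_self P3, abs_nonneg P1, abs_nonneg P2]

lemma eq0 (hw : OleinikSolution X p w α m M C₀ δ₁) {x ψ : ℝ} (h : (x, ψ) ∈ Om X δ₁) :
    D1 w x ψ = √(w x ψ) * D2 (D2 w) x ψ - 2 * deriv p x := by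
  have := hw.eqn x ⟨h.1.1, h.1.2.le⟩ ψ h.2.1
  rw [pd10, pd02] at this
  linarith

lemma comm2 {Ω : Set (ℝ × ℝ)} {f : ℝ → ℝ → ℝ} (hΩ : IsOpen Ω) (hf : Sm Ω f) {x ψ : ℝ}
    (h : (x, ψ) ∈ Ω) : D1 (D2 (D2 f)) x ψ = D2 (D2 (D1 f)) x ψ := by
  rw [(hf.d2 hΩ).comm hΩ h]
  exact D2_congr hΩ (fun a b hab => hf.comm hΩ hab) h

lemma eq1 (hw : OleinikSolution X p w α m M C₀ δ₁) {x ψ : ℝ} (h : (x, ψ) ∈ Om X δ₁) :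
    D1 (D1 w) x ψ = √(w x ψ) * D2 (D2 (D1 w)) x ψ + Ff p w x ψ := by
  have hΩ := isOpen_Om X δ₁
  have s := smw hw
  have hp := wpos hw h
  have e := D1_congr hΩ (f := D1 w) (g := fun x ψ => √(w x ψ) * D2 (D2 w) x ψ - 2 * deriv p x)
    (fun a b hab => eq0 hw hab) h
  have d := (((s.h1 hΩ h).sqrt hp.ne').mul (((s.d2 hΩ).d2 hΩ).h1 hΩ h)).sub ((hp1 hw x).const_mul 2)
  have d' : D1 (fun x ψ => √(w x ψ) * D2 (D2 w) x ψ - 2 * deriv p x) x ψ = _ := d.deriv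
  rw [e, d', comm2 hΩ s h, Ff]
  have e0 := eq0 hw h
  have hs : √(w x ψ) ≠ 0 := (Real.sqrt_pos.2 hp).ne'
  have hsq : √(w x ψ) ^ 2 = w x ψ := Real.sq_sqrt hp.le
  have e0' : D2 (D2 w) x ψ = (D1 w x ψ + 2 * deriv p x) / √(w x ψ) := by
    field_simp; linarith
  rw [e0']
  have : D1 w x ψ / (2 * √(w x ψ)) * ((D1 w x ψ + 2 * deriv p x) / √(w x ψ))
      = D1 w x ψ * (D1 w x ψ + 2 * deriv p x) / (2 * w x ψ) := by
    rw [div_mul_div_comm]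
    congr 1
    rw [← hsq]; ring_nf
    simp
  rw [this]
  ring

noncomputable def F2 (p : ℝ → ℝ) (w : ℝ → ℝ → ℝ) (x ψ : ℝ) : ℝ :=
  D2 (D1 w) x ψ * (D1 w x ψ + deriv p x) / w x ψ
    - D1 w x ψ * (D1 w x ψ + 2 * deriv p x) * D2 w x ψ / (2 * w x ψ ^ 2)

lemma eq2 (hw : OleinikSolution X p w α m M C₀ δ₁) {x ψ : ℝ} (h : (x, ψ) ∈ Om X δ₁) :
    D1 (D2 (D1 w)) x ψ = √(w x ψ) * D2 (D2 (D2 (D1 w))) x ψ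
      + D2 w x ψ / (2 * √(w x ψ)) * D2 (D2 (D1 w)) x ψ + F2 p w x ψ := by
  have hΩ := isOpen_Om X δ₁
  have s := smw hw
  have hp := wpos hw h
  have su := s.d1 hΩ
  have e := D2_congr hΩ (f := D1 (D1 w))
    (g := fun x ψ => √(w x ψ) * D2 (D2 (D1 w)) x ψ + Ff p w x ψ)
    (fun a b hab => eq1 hw hab) h
  have hu := su.h2 hΩ h
  have hW := s.h2 hΩ h
  have d := ((hW.sqrt hp.ne').mul (((su.d2 hΩ).d2 hΩ).h2 hΩ h)).add
    (((hu.mul (hu.add_const (2 * deriv p x))).div (hW.const_mul 2) (by positivity)).sub_const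
      (2 * deriv (deriv p) x))
  have d' : D2 (fun x ψ => √(w x ψ) * D2 (D2 (D1 w)) x ψ + Ff p w x ψ) x ψ = _ := d.deriv
  rw [su.comm hΩ h, e, d', F2]
  have hs : √(w x ψ) ≠ 0 := (Real.sqrt_pos.2 hp).ne'
  field_simp
  simp only [Pi.mul_apply]
  ring

noncomputable def F3 (p : ℝ → ℝ) (w : ℝ → ℝ → ℝ) (x ψ : ℝ) : ℝ :=
  D1 w x ψ * (D1 (D1 w) x ψ - Ff p w x ψ) / (2 * w x ψ)
    + D1 (D1 w) x ψ * (D1 w x ψ + deriv p x) / w x ψ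
    + D1 w x ψ * deriv (deriv p) x / w x ψ
    - D1 w x ψ ^ 2 * (D1 w x ψ + 2 * deriv p x) / (2 * w x ψ ^ 2) - 2 * deriv (deriv (deriv p)) x

lemma eq3 (hw : OleinikSolution X p w α m M C₀ δ₁) {x ψ : ℝ} (h : (x, ψ) ∈ Om X δ₁) :
    D1 (D1 (D1 w)) x ψ = √(w x ψ) * D2 (D2 (D1 (D1 w))) x ψ + F3 p w x ψ := by
  have hΩ := isOpen_Om X δ₁
  have s := smw hw
  have hp := wpos hw h
  have su := s.d1 hΩ
  have e := D1_congr hΩ (f := D1 (D1 w))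
    (g := fun x ψ => √(w x ψ) * D2 (D2 (D1 w)) x ψ + Ff p w x ψ)
    (fun a b hab => eq1 hw hab) h
  have hu := su.h1 hΩ h
  have hW := s.h1 hΩ h
  have d := ((hW.sqrt hp.ne').mul (((su.d2 hΩ).d2 hΩ).h1 hΩ h)).add
    (((hu.mul (hu.add ((hp1 hw x).const_mul 2))).div (hW.const_mul 2) (by positivity)).sub
      ((hp2 hw x).const_mul 2))
  have d' : D1 (fun x ψ => √(w x ψ) * D2 (D2 (D1 w)) x ψ + Ff p w x ψ) x ψ = _ := d.deriv
  rw [e, d', comm2 hΩ su h, F3]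
  have hs : √(w x ψ) ≠ 0 := (Real.sqrt_pos.2 hp).ne'
  have hsq : √(w x ψ) ^ 2 = w x ψ := Real.sq_sqrt hp.le
  have e1 := eq1 hw h
  have e1' : D2 (D2 (D1 w)) x ψ = (D1 (D1 w) x ψ - Ff p w x ψ) / √(w x ψ) := by
    field_simp; linarith
  have : D1 w x ψ / (2 * √(w x ψ)) * D2 (D2 (D1 w)) x ψ
      = D1 w x ψ * (D1 (D1 w) x ψ - Ff p w x ψ) / (2 * w x ψ) := by
    rw [e1', div_mul_div_comm]
    congr 1
    rw [mul_assoc, ← sq, hsq]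
  rw [this]
  simp only [Pi.mul_apply, Pi.add_apply]
  field_simp
  ring

end eqs

section steps
variable {X : ℝ} {p : ℝ → ℝ} {w : ℝ → ℝ → ℝ} {α m M C₀ δ₁ : ℝ}

lemma ubound (hw : OleinikSolution X p w α m M C₀ δ₁) {x ψ : ℝ} (h : (x, ψ) ∈ Om X δ₁) :
    |D1 w x ψ| ≤ C₀ * √ψ := by
  have h1 := hw.dx_bound x ⟨h.1.1.le, h.1.2.le⟩ ψ ⟨h.2.1.le, h.2.2.le⟩
  rw [pd10] at h1
  refine h1.trans ?_
  rw [Real.sqrt_eq_rpow]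
  refine mul_le_mul_of_nonneg_left ?_ hw.hC₀.le
  exact Real.rpow_le_rpow_of_exponent_ge h.2.1 (h.2.2.trans hw.hδ₁.2).le (by linarith [hw.hα.1])

lemma step1_aux (hw : OleinikSolution X p w α m M C₀ δ₁) {x0 : ℝ} (hx0 : 0 < x0) :
    ∃ A B : ℝ, 0 ≤ A ∧ 0 ≤ B ∧ ∀ σ : ℝ, σ ^ 2 = 1 → ∀ η T : ℝ, 0 < η → η < δ₁ / 2 → x0 < T → T < X →
    ∀ x ∈ Icc x0 T, ∀ ψ ∈ Icc η (δ₁ / 2),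
      σ * (x - x0) * D1 w x ψ - (A * ψ - B * (ψ * √ψ)) - X * C₀ * √η ≤ 0 := by
  obtain ⟨P, hP, HP⟩ := pbound hw
  have hm := hw.hm
  have hX := hw.hX
  have hC := hw.hC₀
  have hδ := hw.hδ₁.1
  have hsm : 0 < √m := Real.sqrt_pos.2 hm
  set B := 4 / (3 * √m) * (C₀ + X * (C₀ ^ 2 / (2 * m)) + 2 * X * P + 1) with hB
  have hB0 : 0 ≤ B := by positivity
  have hBm : 3 / 4 * B * √m = C₀ + X * (C₀ ^ 2 / (2 * m)) + 2 * X * P + 1 := by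
    rw [hB]; field_simp
  have hd : 0 < δ₁ / 2 := by linarith
  have hsd : 0 < √(δ₁ / 2) := Real.sqrt_pos.2 hd
  set A := B * √(δ₁ / 2) + X * C₀ / √(δ₁ / 2) with hA
  have hA0 : 0 ≤ A := by positivity
  have hphi : ∀ s : ℝ, 0 < s → s ≤ δ₁ / 2 → 0 ≤ A * s - B * (s * √s) := by
    intro s hs hs'
    have h1 : √s ≤ √(δ₁ / 2) := Real.sqrt_le_sqrt hs'
    have h2 : B * √s ≤ A := by
      have : 0 ≤ X * C₀ / √(δ₁ / 2) := by positivity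
      have := mul_le_mul_of_nonneg_left h1 hB0
      linarith
    have := mul_le_mul_of_nonneg_right h2 hs.le
    linarith
  refine ⟨A, B, hA0, hB0, ?_⟩
  intro σ hσ η T hη hηd hxT hTX
  have hΩ := isOpen_Om X δ₁
  have s := smw hw
  have su := s.d1 hΩ
  have hσ1 : |σ| = 1 := by
    have : |σ| ^ 2 = 1 := by rw [sq_abs, hσ]
    have h0 : (|σ| - 1) * (|σ| + 1) = 0 := by linarith
    rcases mul_eq_zero.1 h0 with h | h
    · linarith
    · linarith [abs_nonneg σ]
  have mem : ∀ t ∈ Icc x0 T, ∀ s ∈ Icc η (δ₁ / 2), (t, s) ∈ Om X δ₁ := by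
    intro t ht s hs
    exact ⟨⟨hx0.trans_le ht.1, ht.2.trans_lt hTX⟩, ⟨hη.trans_le hs.1, by linarith [hs.2]⟩⟩
  have ub : ∀ t ∈ Icc x0 T, ∀ s ∈ Icc η (δ₁ / 2),
      σ * (t - x0) * D1 w t s ≤ X * C₀ * √s := by
    intro t ht s hs
    have h1 := ubound hw (mem t ht s hs)
    have h2 : |t - x0| ≤ X := by rw [abs_of_nonneg (by linarith [ht.1])]; linarith [ht.2]
    calc σ * (t - x0) * D1 w t s ≤ |σ * (t - x0) * D1 w t s| := le_abs_self _
      _ = |t - x0| * |D1 w t s| := by rw [abs_mul, abs_mul, hσ1, one_mul]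
      _ ≤ X * (C₀ * √s) := by gcongr
      _ = _ := by ring
  refine maxpr
    (ht := fun t s => σ * D1 w t s + σ * (t - x0) * D1 (D1 w) t s)
    (hs := fun t s => σ * (t - x0) * D2 (D1 w) t s - (A - B * (3 / 2 * √s)))
    (hss := fun t s => σ * (t - x0) * D2 (D2 (D1 w)) t s + B * (3 / 2 * (1 / (2 * √s))))
    ?_ ?_ ?_ ?_ ?_ ?_ ?_ ?_
  · have c1 : ContinuousOn (fun z : ℝ × ℝ => D1 w z.1 z.2) (Icc x0 T ×ˢ Icc η (δ₁ / 2)) :=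
      (ContDiffOn.continuousOn su).mono (fun z hz => mem z.1 hz.1 z.2 hz.2)
    have c2 : ContinuousOn (fun z : ℝ × ℝ => σ * (z.1 - x0)) (Icc x0 T ×ˢ Icc η (δ₁ / 2)) := by
      fun_prop
    have c3 : ContinuousOn (fun z : ℝ × ℝ => A * z.2 - B * (z.2 * √z.2))
      (Icc x0 T ×ˢ Icc η (δ₁ / 2)) := by fun_prop
    exact ((c2.mul c1).sub c3).sub continuousOn_const
  · intro t ht s hs
    have h1 := su.h1 hΩ (mem t (Ioc_subset_Icc_self ht) s (Ioo_subset_Icc_self hs))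
    have h2 : HasDerivAt (fun t' => σ * (t' - x0)) σ t := by
      simpa using ((hasDerivAt_id t).sub_const x0).const_mul σ
    exact ((h2.mul h1).sub_const _).sub_const _
  · intro t ht s hs
    have h1 := su.h2 hΩ (mem t (Ioc_subset_Icc_self ht) s (Ioo_subset_Icc_self hs))
    have hs0 : 0 < s := hη.trans hs.1
    have h2 := (hasDerivAt_id s).mul ((hasDerivAt_id s).sqrt hs0.ne')
    refine (((h1.const_mul (σ * (t - x0))).sub
      (((hasDerivAt_id s).const_mul A).sub (h2.const_mul B))).sub_const _).congr_deriv ?_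
    have : s / (2 * √s) = √s / 2 := by
      have := Real.sq_sqrt hs0.le
      have h3 := Real.sqrt_pos.2 hs0
      field_simp
      linarith
    have h4 : s * (1 / (2 * √s)) = √s / 2 := by rw [← this]; ring
    simp only [id, h4]
    ring
  · intro t ht s hs
    have h1 := (su.d2 hΩ).h2 hΩ (mem t (Ioc_subset_Icc_self ht) s (Ioo_subset_Icc_self hs))
    have hs0 : 0 < s := hη.trans hs.1
    have h2 := (((hasDerivAt_id s).sqrt hs0.ne').const_mul (3 / 2)).const_mul B
    refine ((h1.const_mul (σ * (t - x0))).sub (h2.const_sub A)).congr_deriv ?_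
    simp only [id]
    ring
  · intro s hs
    have := hphi s (hη.trans_le hs.1) hs.2
    have h2 : 0 ≤ X * C₀ * √η := by positivity
    simp only [sub_self, mul_zero, zero_mul]
    linarith
  · intro t ht
    have := hphi η hη hηd.le
    have h2 := ub t ht η ⟨le_rfl, hηd.le⟩
    linarith
  · intro t ht
    have h2 := ub t ht (δ₁ / 2) ⟨hηd.le, le_rfl⟩
    have h3 : A * (δ₁ / 2) - B * (δ₁ / 2 * √(δ₁ / 2)) = X * C₀ * √(δ₁ / 2) := by
      have h4 := Real.mul_self_sqrt hd.le
      have h5 : X * C₀ / √(δ₁ / 2) * (δ₁ / 2) = X * C₀ * √(δ₁ / 2) := by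
        rw [div_mul_eq_mul_div, div_eq_iff hsd.ne', mul_assoc (X * C₀) (√(δ₁ / 2)), h4]
      rw [hA, add_mul, h5]; ring
    have h6 : 0 ≤ X * C₀ * √η := by positivity
    linarith
  · intro t ht s hs hpos _ hht hhss
    have hmem := mem t (Ioc_subset_Icc_self ht) s (Ioo_subset_Icc_self hs)
    have hs0 : 0 < s := hη.trans hs.1
    have hph := hphi s hs0 hs.2.le
    have hη2 : 0 ≤ X * C₀ * √η := by positivity
    have hxp : 0 < t - x0 := by linarith [ht.1]
    have hxX : t - x0 ≤ X := by linarith [ht.2]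
    have hup : 0 < σ * (t - x0) * D1 w t s := by linarith
    have e1 := eq1 hw hmem
    have hwp := wpos hw hmem
    have hwl := (hw.growth_lb t ⟨hmem.1.1.le, hmem.1.2.le⟩ s ⟨hmem.2.1, hmem.2.2.le⟩).le
    have hul := ubound hw hmem
    have hsa : √m * √s ≤ √(w t s) := by
      rw [← Real.sqrt_mul hm.le]; exact Real.sqrt_le_sqrt hwl
    have hss0 : 0 < √s := Real.sqrt_pos.2 hs0
    have hs1 : √s ≤ 1 := by
      exact Real.sqrt_le_iff.2 ⟨by norm_num, by linarith [hs.2, hw.hδ₁.2]⟩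
    obtain ⟨hP1, hP2, -⟩ := HP t ⟨hmem.1.1.le, hmem.1.2.le⟩
    -- term bounds
    have k1 : σ * D1 w t s ≤ C₀ := by
      calc σ * D1 w t s ≤ |σ * D1 w t s| := le_abs_self _
        _ = |D1 w t s| := by rw [abs_mul, hσ1, one_mul]
        _ ≤ C₀ * √s := hul
        _ ≤ C₀ * 1 := by gcongr
        _ = C₀ := mul_one _
    have k2 : σ * (t - x0) * D1 w t s * deriv p t / w t s ≤ 0 :=
      div_nonpos_of_nonpos_of_nonneg
        (mul_nonpos_of_nonneg_of_nonpos hup.le (hw.hfav t)) hwp.le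
    have k3 : σ * (t - x0) * (D1 w t s ^ 2 / (2 * w t s)) ≤ X * (C₀ ^ 2 / (2 * m)) := by
      have a1 : D1 w t s ^ 2 ≤ C₀ ^ 2 * s := by
        have := sq_le_sq' (by linarith [(abs_le.1 hul).1]) (abs_le.1 hul).2
        rwa [mul_pow, Real.sq_sqrt hs0.le] at this
      have a2 : D1 w t s ^ 2 / (2 * w t s) ≤ C₀ ^ 2 / (2 * m) := by
        rw [div_le_div_iff₀ (by positivity) (by positivity)]
        have b1 := mul_le_mul_of_nonneg_right a1 (by positivity : 0 ≤ 2 * m)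
        have b2 := mul_le_mul_of_nonneg_left hwl (by positivity : 0 ≤ 2 * C₀ ^ 2)
        linarith
      have a3 : σ * (t - x0) ≤ X := by
        have : σ ≤ 1 := by rw [← hσ1]; exact le_abs_self _
        have := mul_le_mul_of_nonneg_right this hxp.le
        linarith
      calc _ ≤ X * (D1 w t s ^ 2 / (2 * w t s)) := by gcongr
        _ ≤ _ := by gcongr
    have k4 : - (σ * (t - x0) * (2 * deriv (deriv p) t)) ≤ 2 * X * P := by
      calc _ ≤ |σ * (t - x0) * (2 * deriv (deriv p) t)| := neg_le_abs _
        _ = (t - x0) * (2 * |deriv (deriv p) t|) := by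
          rw [abs_mul, abs_mul, abs_mul, hσ1, abs_of_pos hxp]; norm_num
        _ ≤ X * (2 * P) := by gcongr
        _ = _ := by ring
    have k5 : σ * (t - x0) * Ff p w t s = σ * (t - x0) * (D1 w t s ^ 2 / (2 * w t s))
        + σ * (t - x0) * D1 w t s * deriv p t / w t s - σ * (t - x0) * (2 * deriv (deriv p) t) := by
      rw [Ff]; field_simp
    have k6 : 3 / 4 * B * √m ≤ √(w t s) * (B * (3 / 2 * (1 / (2 * √s)))) := by
      have : √(w t s) * (B * (3 / 2 * (1 / (2 * √s)))) = 3 / 4 * B * (√(w t s) / √s) := by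
        field_simp; ring
      rw [this]
      gcongr
      rwa [le_div_iff₀ hss0]
    have k7 := mul_nonneg_of_nonpos_of_nonpos (neg_nonpos.2 (Real.sqrt_nonneg (w t s))) hhss
    rw [e1] at hht
    have k8 : σ * (t - x0) * (√(w t s) * D2 (D2 (D1 w)) t s + Ff p w t s) =
      √(w t s) * (σ * (t - x0) * D2 (D2 (D1 w)) t s) + σ * (t - x0) * Ff p w t s := by ring
    rw [k8] at hht
    linarith

lemma step1 (hw : OleinikSolution X p w α m M C₀ δ₁) {x1 : ℝ} (hx1 : 0 < x1) :
    ∃ C > 0, ∀ x ∈ Ico x1 X, ∀ ψ ∈ Ioo 0 (δ₁ / 2), |D1 w x ψ| ≤ C * ψ := by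
  obtain ⟨A, B, hA, hB, H⟩ := step1_aux hw (x0 := x1 / 2) (by linarith)
  refine ⟨A / (x1 / 2) + 1, by positivity, ?_⟩
  intro x hx ψ hψ
  have key : ∀ σ : ℝ, σ ^ 2 = 1 → σ * (x - x1 / 2) * D1 w x ψ ≤ A * ψ := by
    intro σ hσ
    have t : Tendsto (fun η => A * ψ + X * C₀ * √η) (𝓝[>] 0) (𝓝 (A * ψ + X * C₀ * √0)) := by
      have : Continuous fun η => A * ψ + X * C₀ * √η := by fun_prop
      exact (this.tendsto 0).mono_left nhdsWithin_le_nhds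
    rw [Real.sqrt_zero, mul_zero, add_zero] at t
    refine ge_of_tendsto t ?_
    filter_upwards [Ioo_mem_nhdsGT hψ.1] with η hη
    have h1 := H σ hσ η x hη.1 (hη.2.trans hψ.2) (by linarith [hx.1]) hx.2 x
      ⟨by linarith [hx.1], le_rfl⟩ ψ ⟨hη.2.le, hψ.2.le⟩
    have h2 : 0 ≤ B * (ψ * √ψ) := by have := hψ.1; positivity
    linarith
  have k1 := key 1 (by norm_num)
  have k2 := key (-1) (by norm_num)
  have hp : 0 < x - x1 / 2 := by linarith [hx.1]
  have k3 : (x - x1 / 2) * |D1 w x ψ| ≤ A * ψ := by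
    rcases abs_cases (D1 w x ψ) with h | h <;> rw [h.1] <;> linarith
  have k4 : x1 / 2 * |D1 w x ψ| ≤ A * ψ :=
    (mul_le_mul_of_nonneg_right (by linarith [hx.1]) (abs_nonneg _)).trans k3
  have k5 : |D1 w x ψ| ≤ A / (x1 / 2) * ψ := by
    rw [div_mul_eq_mul_div, le_div_iff₀ (by positivity)]; linarith
  linarith [hψ.1]

end steps

lemma mulb {a b A B : ℝ} (ha : |a| ≤ A) (hb : |b| ≤ B) : |a * b| ≤ A * B := by
  rw [abs_mul]
  exact mul_le_mul ha hb (abs_nonneg _) ((abs_nonneg _).trans ha)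

lemma addb {a b A B : ℝ} (ha : |a| ≤ A) (hb : |b| ≤ B) : |a + b| ≤ A + B :=
  (abs_add_le a b).trans (add_le_add ha hb)

lemma subb {a b A B : ℝ} (ha : |a| ≤ A) (hb : |b| ≤ B) : |a - b| ≤ A + B :=
  (abs_sub a b).trans (add_le_add ha hb)

section alg
variable {N r θ u iW W p1 p2 p3 q z V : ℝ}

lemma FfB (hN : 1 ≤ N) (hr : 0 < r) (hW : 0 < W) (hu : u = θ * r ^ 2) (hiW : iW * W = r ^ 2)
    (hθ : |θ| ≤ N) (hu' : |u| ≤ N) (hi : |iW| ≤ N) (h1 : |p1| ≤ N) (h2 : |p2| ≤ N) :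
    |u * (u + 2 * p1) / (2 * W) - 2 * p2| ≤ 4 * N ^ 3 := by
  have e : u * (u + 2 * p1) / (2 * W) - 2 * p2 = θ * (u + 2 * p1) * iW * (1 / 2) - 2 * p2 := by
    have : u * (u + 2 * p1) / (2 * W) = θ * (u + 2 * p1) * iW * (1 / 2) := by
      rw [div_eq_iff (by positivity)]
      calc u * (u + 2 * p1) = (θ * r ^ 2) * (u + 2 * p1) := by rw [← hu]
        _ = _ := by rw [← hiW]; ring
    rw [this]
  rw [e]
  have h2' : |(2 : ℝ)| ≤ 2 := by norm_num
  have hh : |(1 / 2 : ℝ)| ≤ 1 / 2 := by rw [abs_of_pos] <;> norm_num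
  refine (subb (mulb (mulb (mulb hθ (addb hu' (mulb h2' h1))) hi) hh) (mulb h2' h2)).trans ?_
  have : N ≤ N ^ 3 := le_self_pow₀ hN (by norm_num)
  have : 0 ≤ N ^ 3 := by positivity
  linarith

lemma F2B (hN : 1 ≤ N) (hr : 0 < r) (hr1 : r ≤ 1) (hW : 0 < W) (hu : u = θ * r ^ 2)
    (hiW : iW * W = r ^ 2)
    (hθ : |θ| ≤ N) (hu' : |u| ≤ N) (hi : |iW| ≤ N) (h1 : |p1| ≤ N) (hV : |V| ≤ N) :
    |r ^ 3 * (q * (u + p1) / W - u * (u + 2 * p1) * V / (2 * W ^ 2))| ≤ 2 * N ^ 5 * (1 + |q|) := by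
  have e : r ^ 3 * (q * (u + p1) / W - u * (u + 2 * p1) * V / (2 * W ^ 2))
      = r * (q * (u + p1) * iW - θ * (u + 2 * p1) * V * (iW * iW) * (1 / 2)) := by
    have a1 : r ^ 2 * (q * (u + p1) / W) = q * (u + p1) * iW := by
      rw [← hiW]; field_simp
    have a2 : r ^ 2 * (u * (u + 2 * p1) * V / (2 * W ^ 2))
        = θ * (u + 2 * p1) * V * (iW * iW) * (1 / 2) := by
      have : r ^ 2 * (u * (u + 2 * p1) * V / (2 * W ^ 2))
        = (iW * W) * ((θ * (iW * W)) * (u + 2 * p1) * V / (2 * W ^ 2)) := by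
        rw [hiW, ← hu]
      rw [this]; field_simp
    rw [← a1, ← a2]; ring
  rw [e]
  have h2' : |(2 : ℝ)| ≤ 2 := by norm_num
  have hh : |(1 / 2 : ℝ)| ≤ 1 / 2 := by rw [abs_of_pos] <;> norm_num
  have hra : |r| ≤ 1 := by rwa [abs_of_pos hr]
  refine (mulb hra (subb (mulb (mulb (le_refl |q|) (addb hu' h1)) hi)
    (mulb (mulb (mulb (mulb hθ (addb hu' (mulb h2' h1))) hV) (mulb hi hi)) hh))).trans ?_
  have b1 : N ^ 2 ≤ N ^ 5 := pow_le_pow_right₀ hN (by norm_num)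
  have b2 := mul_le_mul_of_nonneg_right b1 (abs_nonneg q)
  have b3 : 0 ≤ N ^ 5 := by positivity
  linarith

lemma F3B {F : ℝ} (hN : 1 ≤ N) (hr : 0 < r) (hr1 : r ≤ 1) (hW : 0 < W) (hu : u = θ * r ^ 2)
    (hiW : iW * W = r ^ 2)
    (hθ : |θ| ≤ N) (hu' : |u| ≤ N) (hi : |iW| ≤ N) (h1 : |p1| ≤ N) (h2 : |p2| ≤ N)
    (h3 : |p3| ≤ N) (hF : |F| ≤ 4 * N ^ 3) :
    |r * (r ^ 3 * (u * (z - F) / (2 * W) + z * (u + p1) / W + u * p2 / W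
      - u ^ 2 * (u + 2 * p1) / (2 * W ^ 2) - 2 * p3))| ≤ 10 * N ^ 5 * (1 + |r * z|) := by
  have e : r * (r ^ 3 * (u * (z - F) / (2 * W) + z * (u + p1) / W + u * p2 / W
      - u ^ 2 * (u + 2 * p1) / (2 * W ^ 2) - 2 * p3))
      = (r ^ 3 * (θ * iW * (1 / 2) * (r * z)) + r * ((r * z) * (u + p1) * iW))
        + r ^ 4 * (θ * p2 * iW - θ * F * iW * (1 / 2) -
        (θ * θ) * (u + 2 * p1) * (iW * iW) * (1 / 2) - 2 * p3) := by
    have a0 : u / W = θ * iW := by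
      rw [div_eq_iff hW.ne', hu, ← hiW]; ring
    have a1 : u * (z - F) / (2 * W) = θ * iW * (1 / 2) * (z - F) := by
      rw [← a0]; field_simp
    have a2 : u * p2 / W = θ * p2 * iW := by
      have : u * p2 / W = u / W * p2 := by ring
      rw [this, a0]; ring
    have a3 : u ^ 2 * (u + 2 * p1) / (2 * W ^ 2) = (θ * θ) * (u + 2 * p1) * (iW * iW) * (1 / 2) := by
      have : u ^ 2 * (u + 2 * p1) / (2 * W ^ 2) = (u / W) ^ 2 * (u + 2 * p1) * (1 / 2) := by
        field_simp
      rw [this, a0]; ring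
    have a4 : r ^ 2 * (z * (u + p1) / W) = z * (u + p1) * iW := by
      rw [← hiW]; field_simp
    rw [a1, a2, a3]
    have : z * (u + p1) * iW * r ^ 2 = r ^ 4 * (z * (u + p1) / W) := by rw [← a4]; ring
    linarith
  rw [e]
  have h2' : |(2 : ℝ)| ≤ 2 := by norm_num
  have hh : |(1 / 2 : ℝ)| ≤ 1 / 2 := by rw [abs_of_pos] <;> norm_num
  have hra : |r| ≤ 1 := by rwa [abs_of_pos hr]
  have hrk : ∀ k : ℕ, |r ^ k| ≤ 1 := fun k => by
    rw [abs_of_pos (by positivity)]; exact pow_le_one₀ hr.le hr1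
  refine (addb (addb (mulb (hrk 3) (mulb (mulb (mulb hθ hi) hh) (le_refl |r * z|)))
    (mulb hra (mulb (mulb (le_refl |r * z|) (addb hu' h1)) hi)))
    (mulb (hrk 4) (subb (subb (subb (mulb (mulb hθ h2) hi) (mulb (mulb (mulb hθ hF) hi) hh))
      (mulb (mulb (mulb (mulb hθ hθ) (addb hu' (mulb h2' h1))) (mulb hi hi)) hh))
      (mulb h2' h3)))).trans ?_
  have b1 : N ^ 2 ≤ N ^ 5 := pow_le_pow_right₀ hN (by norm_num)
  have b4 : N ^ 3 ≤ N ^ 5 := pow_le_pow_right₀ hN (by norm_num)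
  have b5 : N ≤ N ^ 5 := le_self_pow₀ hN (by norm_num)
  have b2 := mul_le_mul_of_nonneg_right b1 (abs_nonneg (r * z))
  have b3 : 0 ≤ N ^ 5 := by positivity
  have b6 : 0 ≤ N ^ 5 * |r * z| := by positivity
  linarith

end alg

section steps2
variable {X : ℝ} {p : ℝ → ℝ} {w : ℝ → ℝ → ℝ} {α m M C₀ δ₁ : ℝ}

lemma boxN (hw : OleinikSolution X p w α m M C₀ δ₁) {C1 N0 : ℝ} (hC1 : 0 ≤ C1) (hN0 : 0 ≤ N0) :
    ∃ N ≥ 1, N0 ≤ N ∧ ∀ r x ψ : ℝ, 0 < r → r ≤ 1 → (x, ψ) ∈ Om X δ₁ →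
      ψ ∈ Icc (r ^ 2 / 2) (3 * r ^ 2 / 2) → |D1 w x ψ| ≤ C1 * ψ →
      ∃ θ iW : ℝ, D1 w x ψ = θ * r ^ 2 ∧ iW * w x ψ = r ^ 2 ∧ |θ| ≤ N ∧ |D1 w x ψ| ≤ N ∧ |iW| ≤ N ∧
      |deriv p x| ≤ N ∧ |deriv (deriv p) x| ≤ N ∧ |deriv (deriv (deriv p)) x| ≤ N ∧
      |D2 w x ψ| ≤ N ∧ 1 / N * r ≤ √(w x ψ) ∧ √(w x ψ) ≤ N * r ∧
      r * |D2 w x ψ / (2 * √(w x ψ))| ≤ N := by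
  obtain ⟨P, hP, HP⟩ := pbound hw
  have hm := hw.hm
  have hM : 0 < M := hm.trans hw.hmM
  set l0 := √(m / 2) with hl0
  have hl0p : 0 < l0 := Real.sqrt_pos.2 (by positivity)
  have q1 : 0 ≤ 2 / m := by positivity
  have q2 : 0 ≤ 1 / l0 := by positivity
  have q3 : 0 ≤ √(3 * M / 2) := by positivity
  have q4 : 0 ≤ M / (2 * l0) := by positivity
  set N := 1 + N0 + 2 * C1 + 2 / m + P + M + 1 / l0 + √(3 * M / 2) + M / (2 * l0) with hN
  have hN1 : 1 ≤ N := by linarith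
  refine ⟨N, hN1, by linarith, ?_⟩
  intro r x ψ hr hr1 hmem hψ hu
  have hr2 : 0 < r ^ 2 := by positivity
  have hwp := wpos hw hmem
  have hxI : x ∈ Icc 0 X := ⟨hmem.1.1.le, hmem.1.2.le⟩
  have hwl := (hw.growth_lb x hxI ψ ⟨hmem.2.1, hmem.2.2.le⟩).le
  have hwu := (hw.growth_ub x hxI ψ ⟨hmem.2.1, hmem.2.2.le⟩).le
  have hd1 := hw.slope_lb x hxI ψ ⟨hmem.2.1.le, hmem.2.2.le⟩
  have hd2 := hw.slope_ub x hxI ψ ⟨hmem.2.1.le, hmem.2.2.le⟩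
  rw [pd01] at hd1 hd2
  obtain ⟨hp1, hp2, hp3⟩ := HP x hxI
  have hwl' : m / 2 * r ^ 2 ≤ w x ψ := by
    have := mul_le_mul_of_nonneg_left hψ.1 hm.le; linarith
  have hwu' : w x ψ ≤ 3 * M / 2 * r ^ 2 := by
    have := mul_le_mul_of_nonneg_left hψ.2 hM.le; linarith
  have hul : |D1 w x ψ| ≤ 2 * C1 * r ^ 2 := by
    have := mul_le_mul_of_nonneg_left hψ.2 hC1
    have : 0 ≤ C1 * r ^ 2 := by positivity
    linarith
  have hD : |D2 w x ψ| ≤ M := by rw [abs_of_pos (hm.trans hd1)]; exact hd2.le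
  have hsl : l0 * r ≤ √(w x ψ) := by
    have : l0 * r = √(m / 2 * r ^ 2) := by
      rw [Real.sqrt_mul (by positivity), Real.sqrt_sq hr.le]
    rw [this]; exact Real.sqrt_le_sqrt hwl'
  have hsu : √(w x ψ) ≤ √(3 * M / 2) * r := by
    have : √(3 * M / 2) * r = √(3 * M / 2 * r ^ 2) := by
      rw [Real.sqrt_mul (by positivity), Real.sqrt_sq hr.le]
    rw [this]; exact Real.sqrt_le_sqrt hwu'
  have hsp := Real.sqrt_pos.2 hwp
  refine ⟨D1 w x ψ / r ^ 2, r ^ 2 / w x ψ, by field_simp, by field_simp, ?_, ?_, ?_,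
    by linarith, by linarith, by linarith, by linarith, ?_, ?_, ?_⟩
  · rw [abs_div, abs_of_pos hr2, div_le_iff₀ hr2]
    refine hul.trans ?_
    gcongr
    linarith
  · have : r ^ 2 ≤ 1 := pow_le_one₀ hr.le hr1
    have := mul_le_mul_of_nonneg_left this (by positivity : 0 ≤ 2 * C1)
    linarith
  · rw [abs_of_pos (by positivity)]
    have : r ^ 2 / w x ψ ≤ 2 / m := by
      rw [div_le_div_iff₀ hwp hm]; linarith
    linarith
  · refine le_trans ?_ hsl
    gcongr
    rw [div_le_iff₀ (by linarith)]
    have h1 : 1 / l0 ≤ N := by linarith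
    rw [div_le_iff₀ hl0p] at h1
    linarith
  · refine hsu.trans ?_
    gcongr
    linarith
  · rw [abs_div, abs_of_pos (by positivity : 0 < 2 * √(w x ψ))]
    have : r * (|D2 w x ψ| / (2 * √(w x ψ))) ≤ M / (2 * l0) := by
      rw [← mul_div_assoc, div_le_div_iff₀ (by positivity) (by positivity)]
      have a1 := mul_le_mul_of_nonneg_left hD (by positivity : 0 ≤ r * (2 * l0))
      have a2 := mul_le_mul_of_nonneg_left hsl (by positivity : 0 ≤ 2 * M)
      linarith
    linarith

lemma step2 (hw : OleinikSolution X p w α m M C₀ δ₁) {C1 x1 x2 d1 : ℝ} (hC1 : 0 ≤ C1)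
    (hx1 : 0 < x1) (hx12 : x1 < x2) (hd1 : 0 < d1) (hd1' : d1 < δ₁)
    (H1 : ∀ x ∈ Ico x1 X, ∀ ψ ∈ Ioc 0 d1, |D1 w x ψ| ≤ C1 * ψ) :
    ∃ d2 > 0, ∃ C2 > 0, ∀ x ∈ Ico x2 X, ∀ ψ ∈ Ioc 0 d2, |D2 (D1 w) x ψ| ≤ C2 := by
  obtain ⟨N, hN1, -, HN⟩ := boxN hw hC1 le_rfl
  have hN0 : 0 < N := by linarith
  obtain ⟨K, hK, HK⟩ := bern_scaled (lam := 1 / (2 * N)) (Lam := 100 * N ^ 10) (by positivity)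
    (by positivity)
  refine ⟨min (d1 / 2) (min 1 (x2 - x1)), by
    refine lt_min (by linarith) (lt_min one_pos (by linarith)), K, hK, ?_⟩
  intro x hx ψ hψ
  have hψ1 : ψ ≤ d1 / 2 := hψ.2.trans (min_le_left _ _)
  have hψ2 : ψ ≤ 1 := hψ.2.trans ((min_le_right _ _).trans (min_le_left _ _))
  have hψ3 : ψ ≤ x2 - x1 := hψ.2.trans ((min_le_right _ _).trans (min_le_right _ _))
  set r := √ψ with hr
  have hr0 : 0 < r := Real.sqrt_pos.2 hψ.1
  have hr2 : r ^ 2 = ψ := Real.sq_sqrt hψ.1.le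
  have hr1 : r ≤ 1 := Real.sqrt_le_iff.2 ⟨by norm_num, by linarith⟩
  have hr3 : r ^ 3 ≤ ψ := by rw [← hr2]; exact pow_le_pow_of_le_one hr0.le hr1 (by norm_num)
  have hΩ := isOpen_Om X δ₁
  have s := smw hw
  have su := s.d1 hΩ
  have := HK (Om X δ₁) (D2 (D1 w)) (D1 w) (fun x ψ => √(w x ψ))
    (fun x ψ => D2 w x ψ / (2 * √(w x ψ))) (F2 p w) r (1 / r ^ 2) 1 x hΩ hr0 (su.d2 hΩ) su ?_
  · rw [one_mul, hr2] at this; exact this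
  intro x' hx' ψ' hψ'
  have hx'1 : x' ∈ Ico x1 X := ⟨by linarith [hx'.1, hx.1], hx'.2.trans_lt hx.2⟩
  have hψ'1 : ψ' ∈ Ioc 0 d1 := ⟨by have := hψ'.1; have := hψ.1; linarith, by
    have := hψ'.2; have := hψ.1; linarith⟩
  have hmem : (x', ψ') ∈ Om X δ₁ := ⟨⟨hx1.trans_le hx'1.1, hx'1.2⟩, ⟨hψ'1.1, hψ'1.2.trans_lt hd1'⟩⟩
  obtain ⟨θ, iW, hu, hiW, hθ, hu', hi, h1, h2, h3, hV, hs1, hs2, hb⟩ :=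
    HN r x' ψ' hr0 hr1 hmem hψ' (H1 x' hx'1 ψ' hψ'1)
  have hwp := wpos hw hmem
  have hpow : ∀ k : ℕ, k ≤ 10 → N ^ k ≤ N ^ 10 := fun k hk => pow_le_pow_right₀ hN1 hk
  have hN10 : N ≤ N ^ 10 := le_self_pow₀ hN1 (by norm_num)
  have hFf := FfB hN1 hr0 hwp hu hiW hθ hu' hi h1 h2
  have hF2 := F2B (q := D2 (D1 w) x' ψ') hN1 hr0 hr1 hwp hu hiW hθ hu' hi h1 hV
  have hpos10 : 0 < N ^ 10 := by positivity
  have hlam : 1 / (2 * N) ≤ 1 / N := by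
    apply one_div_le_one_div_of_le hN0; linarith
  refine ⟨hmem, ?_, ?_, ?_, ?_, ?_, eq2 hw hmem, ?_⟩
  · exact (mul_le_mul_of_nonneg_right hlam hr0.le).trans hs1
  · exact hs2.trans (mul_le_mul_of_nonneg_right (by linarith) hr0.le)
  · linarith
  · rw [one_mul, one_mul]
    refine hF2.trans ?_
    gcongr
    · norm_num
    · norm_num
  · have : 1 / r ^ 2 * D1 w x' ψ' = θ := by rw [hu]; field_simp
    rw [this]; linarith
  · rw [eq1 hw hmem]
    set a := √(w x' ψ')
    have e : (1 / r ^ 2) ^ 2 * r ^ 3 * (2 * D1 w x' ψ' * (a * D2 (D2 (D1 w)) x' ψ' + Ff p w x' ψ')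
       - a * (2 * D2 (D1 w) x' ψ' ^ 2 + 2 * D1 w x' ψ' * D2 (D2 (D1 w)) x' ψ'))
       = 2 * (r * (θ * Ff p w x' ψ')) - 2 * (a / r) * D2 (D1 w) x' ψ' ^ 2 := by
      have : (1 / r ^ 2) ^ 2 * r ^ 3 = 1 / r := by field_simp
      rw [this]
      have : 1 / r * D1 w x' ψ' = r * θ := by rw [hu]; field_simp
      have e2 : 2 * (r * (θ * Ff p w x' ψ')) = 2 * (1 / r * D1 w x' ψ') * Ff p w x' ψ' := by
        rw [this]; ring
      rw [e2]; ring
    rw [e]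
    have ha : 1 / (2 * N) ≤ a / r := by
      rw [le_div_iff₀ hr0]
      exact (mul_le_mul_of_nonneg_right hlam hr0.le).trans hs1
    have g1 := mul_le_mul_of_nonneg_right ha (sq_nonneg (D2 (D1 w) x' ψ'))
    have g0 : 0 ≤ 1 / (2 * N) * D2 (D1 w) x' ψ' ^ 2 := by positivity
    have hra : |r| ≤ 1 := by rwa [abs_of_pos hr0]
    have g2 := (abs_le.1 (mulb hra (mulb hθ hFf))).2
    have g3 := hpow 4 (by norm_num)
    rw [one_mul]
    change r * (θ * Ff p w x' ψ') ≤ _ at g2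
    linarith

set_option maxHeartbeats 1000000 in
lemma step3 (hw : OleinikSolution X p w α m M C₀ δ₁) {C1 C2 x1 x2 d1 : ℝ} (hC1 : 0 ≤ C1)
    (hC2 : 0 ≤ C2)
    (hx1 : 0 < x1) (hx12 : x1 < x2) (hd1 : 0 < d1) (hd1' : d1 < δ₁)
    (H1 : ∀ x ∈ Ico x1 X, ∀ ψ ∈ Ioc 0 d1, |D1 w x ψ| ≤ C1 * ψ)
    (H2 : ∀ x ∈ Ico x1 X, ∀ ψ ∈ Ioc 0 d1, |D2 (D1 w) x ψ| ≤ C2) :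
    ∃ d2 > 0, d2 ≤ d1 ∧ ∃ C3 > 0, ∀ x ∈ Ico x2 X, ∀ ψ ∈ Ioc 0 d2,
      |√ψ * D1 (D1 w) x ψ| ≤ C3 ∧ |ψ * D2 (D2 (D1 w)) x ψ| ≤ C3 := by
  obtain ⟨N, hN1, hC2N, HN⟩ := boxN hw hC1 hC2
  have hN0 : 0 < N := by linarith
  obtain ⟨K, hK, HK⟩ := bern_scaled (lam := 1 / (2 * N)) (Lam := 100 * N ^ 10) (by positivity)
    (by positivity)
  refine ⟨min (d1 / 2) (min 1 (x2 - x1)), by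
    refine lt_min (by linarith) (lt_min one_pos (by linarith)),
    (min_le_left _ _).trans (by linarith), K + N * (K + 4 * N ^ 3), by positivity, ?_⟩
  intro x hx ψ hψ
  have hψ1 : ψ ≤ d1 / 2 := hψ.2.trans (min_le_left _ _)
  have hψ2 : ψ ≤ 1 := hψ.2.trans ((min_le_right _ _).trans (min_le_left _ _))
  have hψ3 : ψ ≤ x2 - x1 := hψ.2.trans ((min_le_right _ _).trans (min_le_right _ _))
  set r := √ψ with hr
  have hr0 : 0 < r := Real.sqrt_pos.2 hψ.1
  have hr2 : r ^ 2 = ψ := Real.sq_sqrt hψ.1.le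
  have hr1 : r ≤ 1 := Real.sqrt_le_iff.2 ⟨by norm_num, by linarith⟩
  have hr3 : r ^ 3 ≤ ψ := by rw [← hr2]; exact pow_le_pow_of_le_one hr0.le hr1 (by norm_num)
  have hΩ := isOpen_Om X δ₁
  have s := smw hw
  have su := s.d1 hΩ
  have hra : |r| ≤ 1 := by rwa [abs_of_pos hr0]
  have hNN : ∀ k : ℕ, k ≤ 10 → N ^ k ≤ N ^ 10 := fun k hk => pow_le_pow_right₀ hN1 hk
  have := HK (Om X δ₁) (D1 (D1 w)) (D2 (D1 w)) (fun x ψ => √(w x ψ))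
    (fun x ψ => 0) (F3 p w) r 1 r x hΩ hr0 (su.d1 hΩ) (su.d2 hΩ) ?_
  · rw [hr2] at this
    refine ⟨this.trans ?_, ?_⟩
    · have : 0 ≤ N * (K + 4 * N ^ 3) := by positivity
      linarith
    · have hx'1 : x ∈ Ico x1 X := ⟨by linarith [hx.1], hx.2⟩
      have hψ'1 : ψ ∈ Ioc 0 d1 := ⟨hψ.1, by linarith⟩
      have hmem : (x, ψ) ∈ Om X δ₁ :=
        ⟨⟨hx1.trans_le hx'1.1, hx'1.2⟩, ⟨hψ'1.1, hψ'1.2.trans_lt hd1'⟩⟩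
      obtain ⟨θ, iW, hu, hiW, hθ, hu', hi, h1, h2, h3, hV, hs1, hs2, hb⟩ :=
        HN r x ψ hr0 hr1 hmem (by rw [hr2]; constructor <;> linarith [hψ.1]) (H1 x hx'1 ψ hψ'1)
      have hwp := wpos hw hmem
      have hFf := FfB hN1 hr0 hwp hu hiW hθ hu' hi h1 h2
      change |Ff p w x ψ| ≤ _ at hFf
      have hsp := Real.sqrt_pos.2 hwp
      have e1 := eq1 hw hmem
      have e2 : ψ * D2 (D2 (D1 w)) x ψ = (r / √(w x ψ)) * (r * D1 (D1 w) x ψ - r * Ff p w x ψ) := by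
        have hh : r * D1 (D1 w) x ψ - r * Ff p w x ψ
            = √(w x ψ) * (r * D2 (D2 (D1 w)) x ψ) := by rw [e1]; ring
        rw [hh, ← mul_assoc, div_mul_cancel₀ _ hsp.ne', ← mul_assoc, ← sq, hr2]
      have e3 : |r / √(w x ψ)| ≤ N := by
        rw [abs_of_pos (by positivity), div_le_iff₀ hsp]
        have := mul_le_mul_of_nonneg_left hs1 hN0.le
        have e4 : N * (1 / N * r) = r := by field_simp
        linarith
      rw [e2]
      refine (mulb e3 (subb this (mulb hra hFf))).trans ?_
      rw [one_mul]; linarith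
  intro x' hx' ψ' hψ'
  have hx'1 : x' ∈ Ico x1 X := ⟨by linarith [hx'.1, hx.1], hx'.2.trans_lt hx.2⟩
  have hψ'1 : ψ' ∈ Ioc 0 d1 := ⟨by have := hψ'.1; have := hψ.1; linarith, by
    have := hψ'.2; have := hψ.1; linarith⟩
  have hmem : (x', ψ') ∈ Om X δ₁ := ⟨⟨hx1.trans_le hx'1.1, hx'1.2⟩, ⟨hψ'1.1, hψ'1.2.trans_lt hd1'⟩⟩
  obtain ⟨θ, iW, hu, hiW, hθ, hu', hi, h1, h2, h3, hV, hs1, hs2, hb⟩ :=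
    HN r x' ψ' hr0 hr1 hmem hψ' (H1 x' hx'1 ψ' hψ'1)
  have hq : |D2 (D1 w) x' ψ'| ≤ N := (H2 x' hx'1 ψ' hψ'1).trans hC2N
  have hwp := wpos hw hmem
  have hN10 : N ≤ N ^ 10 := le_self_pow₀ hN1 (by norm_num)
  have hFf := FfB hN1 hr0 hwp hu hiW hθ hu' hi h1 h2
  change |Ff p w x' ψ'| ≤ _ at hFf
  have hF2 := F2B (q := D2 (D1 w) x' ψ') hN1 hr0 hr1 hwp hu hiW hθ hu' hi h1 hV
  change |r ^ 3 * F2 p w x' ψ'| ≤ _ at hF2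
  have hF3 := F3B (z := D1 (D1 w) x' ψ') hN1 hr0 hr1 hwp hu hiW hθ hu' hi h1 h2 h3 hFf
  change |r * (r ^ 3 * F3 p w x' ψ')| ≤ _ at hF3
  have hpos10 : 0 < N ^ 10 := by positivity
  have hlam : 1 / (2 * N) ≤ 1 / N := by
    apply one_div_le_one_div_of_le hN0; linarith
  refine ⟨hmem, ?_, ?_, ?_, ?_, ?_, ?_, ?_⟩
  · exact (mul_le_mul_of_nonneg_right hlam hr0.le).trans hs1
  · exact hs2.trans (mul_le_mul_of_nonneg_right (by linarith) hr0.le)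
  · rw [abs_zero, mul_zero]; positivity
  · refine hF3.trans ?_
    gcongr
    · norm_num
    · norm_num
  · rw [one_mul]; linarith
  · rw [eq3 hw hmem]; ring
  · rw [eq2 hw hmem]
    have e1 := eq1 hw hmem
    have hsp := Real.sqrt_pos.2 hwp
    set a := √(w x' ψ')
    set q := D2 (D1 w) x' ψ'
    set b := D2 w x' ψ' / (2 * a) with hbdef
    set Q := D2 (D2 (D1 w)) x' ψ'
    set S := r ^ 2 * Q with hS
    set A := a / r with hA
    have hAp : 0 < A := by positivity
    have hA1 : 1 / N ≤ A := by rw [hA, le_div_iff₀ hr0]; exact hs1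
    have hA2 : A ≤ N := by rw [hA, div_le_iff₀ hr0]; exact hs2
    have hb' : |r * b| ≤ N := by rw [abs_mul, abs_of_pos hr0]; exact hb
    have e : 1 ^ 2 * r ^ 3 * (2 * q * (a * D2 (D2 (D2 (D1 w))) x' ψ' + b * Q + F2 p w x' ψ')
       - a * (2 * Q ^ 2 + 2 * q * D2 (D2 (D2 (D1 w))) x' ψ'))
       = 2 * (q * (r * b)) * S + 2 * (q * (r ^ 3 * F2 p w x' ψ')) - 2 * A * S ^ 2 := by
      have : A * S ^ 2 = r ^ 3 * a * Q ^ 2 := by rw [hA, hS]; field_simp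
      have : 2 * A * S ^ 2 = 2 * (r ^ 3 * a * Q ^ 2) := by linarith
      rw [this, hS]; ring
    rw [e]
    set Z := r * D1 (D1 w) x' ψ' with hZ
    set f := r * Ff p w x' ψ' with hf
    have hfb : |f| ≤ 4 * N ^ 3 := by
      have := mulb hra hFf; rwa [one_mul] at this
    have hAS : A * S = Z - f := by
      rw [hZ, hf, e1, hA, hS]; field_simp; ring
    have hg := mulb hq hb'
    set g := q * (r * b)
    -- Young
    have y1 : 2 * g * S ≤ A * S ^ 2 + g ^ 2 / A := by
      have : 0 ≤ (A * S - g) ^ 2 / A := by positivity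
      have e' : (A * S - g) ^ 2 / A = A * S ^ 2 - 2 * g * S + g ^ 2 / A := by field_simp; ring
      linarith
    have y2 : g ^ 2 / A ≤ N ^ 5 := by
      rw [div_le_iff₀ hAp]
      have g1 : g ^ 2 ≤ (N * N) ^ 2 := sq_le_sq' (by linarith [(abs_le.1 hg).1]) (abs_le.1 hg).2
      have g2 : N ^ 5 * (1 / N) ≤ N ^ 5 * A := by gcongr
      have g3 : N ^ 5 * (1 / N) = (N * N) ^ 2 := by field_simp
      linarith
    have y3 : A * S ^ 2 = (Z - f) ^ 2 / A := by rw [← hAS]; field_simp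
    have y4 : (Z - f) ^ 2 / N ≤ (Z - f) ^ 2 / A := by gcongr
    have y5 : Z ^ 2 / 2 - f ^ 2 ≤ (Z - f) ^ 2 := by
      clear_value Z f
      clear * -
      linarith [sq_nonneg (Z - 2 * f), show (Z - f) ^ 2 - (Z ^ 2 / 2 - f ^ 2) = (Z - 2 * f) ^ 2 / 2 by ring]
    have y6 : (Z ^ 2 / 2 - f ^ 2) / N ≤ (Z - f) ^ 2 / N := by gcongr
    have y7 : (Z ^ 2 / 2 - f ^ 2) / N = 1 / (2 * N) * Z ^ 2 - f ^ 2 / N := by field_simp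
    have y8 : f ^ 2 / N ≤ 16 * N ^ 6 := by
      have g1 : f ^ 2 ≤ (4 * N ^ 3) ^ 2 :=
        sq_le_sq' (by linarith [(abs_le.1 hfb).1]) (abs_le.1 hfb).2
      have g2 : f ^ 2 / N ≤ f ^ 2 := div_le_self (sq_nonneg f) hN1
      have g3 : (4 * N ^ 3) ^ 2 = 16 * N ^ 6 := by ring
      linarith
    have y9 : 2 * (q * (r ^ 3 * F2 p w x' ψ')) ≤ 8 * N ^ 7 := by
      have g1 := (abs_le.1 (mulb hq hF2)).2
      have g2 : N * (2 * N ^ 5 * (1 + |q|)) ≤ N * (2 * N ^ 5 * (N + N)) := by gcongr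
      have g3 : N * (2 * N ^ 5 * (N + N)) = 4 * N ^ 7 := by ring
      linarith
    have z1 := hNN 5 (by norm_num)
    have z2 := hNN 6 (by norm_num)
    have z3 := hNN 7 (by norm_num)
    linarith

end steps2

/-- Lower order regularity estimates: for any `0 < ε < X` there exist `δ₂ > 0` and
`C > 0` such that on `[ε,X] × (0,δ₂]` one has `|∂_ψ ∂ₓ w| ≤ C`,
`|∂ₓ² w| ≤ C ψ^{-1/2}` and `|∂_ψ² ∂ₓ w| ≤ C ψ^{-1}`. -/
theorem lower_order_estimates (X : ℝ) (p : ℝ → ℝ) (w : ℝ → ℝ → ℝ) (α m M C₀ δ₁ : ℝ)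
    (hw : OleinikSolution X p w α m M C₀ δ₁)
    (ε : ℝ) (hε : 0 < ε) (hεX : ε < X) :
    ∃ δ₂ > 0, ∃ C > 0,
      ∀ x ∈ Set.Icc ε X, ∀ ψ ∈ Set.Ioc (0 : ℝ) δ₂,
        |pd 1 1 w x ψ| ≤ C ∧
        |pd 2 0 w x ψ| ≤ C * ψ ^ (-(1 : ℝ) / 2) ∧
        |pd 1 2 w x ψ| ≤ C * ψ⁻¹ := by
  have hδ := hw.hδ₁.1
  obtain ⟨C1, hC1, H1⟩ := step1 hw (x1 := ε / 4) (by linarith)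
  obtain ⟨d2, hd2, C2, hC2, H2⟩ := step2 hw (x1 := ε / 4) (x2 := ε / 2) (d1 := δ₁ / 3) hC1.le
    (by linarith) (by linarith) (by linarith) (by linarith)
    (fun x hx ψ hψ => H1 x hx ψ ⟨hψ.1, by linarith [hψ.2]⟩)
  obtain ⟨d3, hd3, hd32, C3, hC3, H3⟩ := step3 hw (x1 := ε / 2) (x2 := ε) (d1 := min (δ₁ / 3) d2)
    hC1.le hC2.le (by linarith) (by linarith) (lt_min (by linarith) hd2)
    ((min_le_left _ _).trans_lt (by linarith))
    (fun x hx ψ hψ => H1 x ⟨by linarith [hx.1], hx.2⟩ ψ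
      ⟨hψ.1, by linarith [hψ.2.trans (min_le_left _ _)]⟩)
    (fun x hx ψ hψ => H2 x hx ψ ⟨hψ.1, hψ.2.trans (min_le_right _ _)⟩)
  refine ⟨d3, hd3, C2 + C3, by positivity, ?_⟩
  intro x hx ψ hψ
  have hΩ := isOpen_Om X δ₁
  have s := smw hw
  have su := s.d1 hΩ
  have hψ1 : ψ ≤ δ₁ / 3 := hψ.2.trans (hd32.trans (min_le_left _ _))
  have hψ2 : ψ ≤ d2 := hψ.2.trans (hd32.trans (min_le_right _ _))
  have hψ0 := hψ.1
  have mem : ∀ x ∈ Ico ε X, (x, ψ) ∈ Om X δ₁ := fun x hx =>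
    ⟨⟨by linarith [hx.1], hx.2⟩, ⟨hψ.1, by linarith⟩⟩
  have hsψ : 0 < √ψ := Real.sqrt_pos.2 hψ0
  have hrp : ψ ^ (-(1 : ℝ) / 2) = (√ψ)⁻¹ := by
    rw [Real.sqrt_eq_rpow, ← Real.rpow_neg hψ0.le]; norm_num
  have b1 : ∀ x ∈ Ico ε X, |D1 (D2 w) x ψ| ≤ C2 + C3 := fun x hx => by
    rw [s.comm hΩ (mem x hx)]
    have := H2 x ⟨by linarith [hx.1], hx.2⟩ ψ ⟨hψ0, hψ2⟩
    linarith
  have b2 : ∀ x ∈ Ico ε X, |D1 (D1 w) x ψ| ≤ (C2 + C3) * ψ ^ (-(1 : ℝ) / 2) := fun x hx => by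
    have := (H3 x hx ψ hψ).1
    rw [abs_mul, abs_of_pos hsψ] at this
    rw [hrp, ← div_eq_mul_inv, le_div_iff₀ hsψ]
    linarith
  have b3 : ∀ x ∈ Ico ε X, |D1 (D2 (D2 w)) x ψ| ≤ (C2 + C3) * ψ⁻¹ := fun x hx => by
    rw [comm2 hΩ s (mem x hx)]
    have := (H3 x hx ψ hψ).2
    rw [abs_mul, abs_of_pos hψ0] at this
    rw [← div_eq_mul_inv, le_div_iff₀ hψ0]
    linarith
  rw [pd11, pd20, pd12]
  rcases hx.2.lt_or_eq with h | h
  · exact ⟨b1 x ⟨hx.1, h⟩, b2 x ⟨hx.1, h⟩, b3 x ⟨hx.1, h⟩⟩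
  · subst h
    refine ⟨endpoint (by positivity) hεX
        (fun x hx => ((s.d2 hΩ).h1 hΩ (mem x hx)).differentiableAt) b1,
      endpoint (by positivity) hεX (fun x hx => (su.h1 hΩ (mem x hx)).differentiableAt) b2,
      endpoint (by positivity) hεX
        (fun x hx => (((s.d2 hΩ).d2 hΩ).h1 hΩ (mem x hx)).differentiableAt) b3⟩
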